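/- arXiv:2104.11062 — 4 statements merged into one kernel-verified Lean document; each statement's English description precedes it below -/
import Mathlib

section
/- Let k be an algebraically closed field and let Z and Z' be finitely generated commutative k-algebras which are integral domains and are integrally closed in their fields of fractions. Then the tensor product Z ⊗_k Z' is an integral domain and is integrally closed in its field of fractions. -/
open scoped TensorProduct

theorem isDomain_tensorProduct_of_isAlgClosed (k A B : Type*) [Field k] [IsAlgClosed k]
    [CommRing A] [CommRing B] [Algebra k A] [Algebra k B] [IsDomain A] [IsDomain B]
    [Algebra.FiniteType k A] : IsDomain (A ⊗[k] B) := by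
  have : NoZeroDivisors (A ⊗[k] B) := by
    refine ⟨fun {x y} hxy ↦ ?_⟩
    let b := Module.Basis.ofVectorSpace k B
    let e := b.baseChange A
    have key (i j) : e.repr x i * e.repr y j = 0 := by
      have : IsJacobsonRing A := isJacobsonRing_of_finiteType (A := k)
      have hJ : (⊥ : Ideal A).jacobson = ⊥ :=
        IsJacobsonRing.out ‹_› (Ideal.isRadical_iff_quotient_reduced _ |>.2 inferInstance)
      rw [← Ideal.mem_bot, ← hJ, Ideal.jacobson, Ideal.mem_sInf]
      rintro m ⟨-, hm⟩
      let := Ideal.Quotient.field m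
      have : Module.Finite k (A ⧸ m) := finite_of_finite_type_of_isJacobsonRing k (A ⧸ m)
      let ev : A →ₐ[k] k := (IsAlgClosed.lift (R := k) (S := A ⧸ m)).comp (Ideal.Quotient.mkₐ k m)
      have hev (a : A) (ha : ev a = 0) : a ∈ m := by
        rw [← Ideal.Quotient.eq_zero_iff_mem]
        exact (map_eq_zero (IsAlgClosed.lift (R := k) (S := A ⧸ m) (M := k))).1 ha
      let φ : A ⊗[k] B →ₐ[k] B :=
        Algebra.TensorProduct.lift ((Algebra.ofId k B).comp ev) (AlgHom.id k B) fun _ _ ↦ .all _ _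
      have hφ (z : A ⊗[k] B) (i) : b.repr (φ z) i = ev (e.repr z i) := by
        induction z with
        | zero => simp
        | add x y hx hy => simp [hx, hy]
        | tmul a c => simp [φ, e, Algebra.ofId_apply, ← Algebra.smul_def, mul_comm (b.repr c i)]
      have h0 : φ x * φ y = 0 := by rw [← map_mul, hxy, map_zero]
      rcases mul_eq_zero.1 h0 with h | h
      · exact m.mul_mem_right _ (hev _ (by simp [← hφ, h]))
      · exact m.mul_mem_left _ (hev _ (by simp [← hφ, h]))
    by_contra! h
    obtain ⟨i, hi⟩ := DFunLike.ne_iff.1 (e.repr.map_ne_zero_iff.2 h.1)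
    obtain ⟨j, hj⟩ := DFunLike.ne_iff.1 (e.repr.map_ne_zero_iff.2 h.2)
    exact mul_ne_zero hi hj (key i j)
  exact NoZeroDivisors.to_isDomain _

theorem IsLocalization.isIntegrallyClosedIn {R S : Type*} [CommRing R] [CommRing S] [Algebra R S]
    [IsDomain R] [IsIntegrallyClosed R] (M : Submonoid R) (hM : M ≤ nonZeroDivisors R)
    [IsLocalization M S] : IsIntegrallyClosedIn R S := by
  have hu (y : M) : IsUnit (algebraMap R (FractionRing R) y) :=
    IsLocalization.map_units (FractionRing R) (⟨y, hM y.2⟩ : nonZeroDivisors R)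
  let f : S →ₐ[R] FractionRing R := IsLocalization.liftAlgHom (M := M) (f := Algebra.ofId _ _) hu
  refine AlgHom.isIntegrallyClosedIn f ?_ (inferInstance : IsIntegrallyClosedIn R (FractionRing R))
  refine (IsLocalization.lift_injective_iff (M := M) (g := algebraMap R (FractionRing R)) hu).2
    fun x y ↦ ?_
  rw [(IsLocalization.injective S hM).eq_iff, (IsFractionRing.injective R (FractionRing R)).eq_iff]

theorem algebraMapSubmonoid_nonZeroDivisors_le {R S : Type*} [CommRing R] [IsDomain R]
    [CommRing S] [IsDomain S] [Algebra R S] [FaithfulSMul R S] :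
    Algebra.algebraMapSubmonoid S (nonZeroDivisors R) ≤ nonZeroDivisors S :=
  map_le_nonZeroDivisors_of_injective _ (FaithfulSMul.algebraMap_injective R S) le_rfl

theorem isIntegrallyClosed_tensorProduct_of_etale (F L R : Type*) [Field F] [Field L]
    [Algebra F L] [Algebra.Etale F L] [Module.Finite F L] [CommRing R] [IsDomain R]
    [IsIntegrallyClosed R] [Algebra F R] [IsDomain (R ⊗[F] L)] :
    IsIntegrallyClosed (R ⊗[F] L) := by
  let K := FractionRing R
  let S := R ⊗[F] L
  have hle : Algebra.algebraMapSubmonoid S (nonZeroDivisors R) ≤ nonZeroDivisors S :=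
    algebraMapSubmonoid_nonZeroDivisors_le
  have : IsDomain (S ⊗[R] K) := IsLocalization.isDomain_of_le_nonZeroDivisors _ hle
  have hinj : Function.Injective (algebraMap S (S ⊗[R] K)) := IsLocalization.injective _ hle
  have : IsIntegrallyClosedIn S (S ⊗[R] K) := by
    rw [isIntegrallyClosedIn_iff]
    refine ⟨hinj, fun {x} hx ↦ ?_⟩
    obtain ⟨y, hy⟩ := (TensorProduct.toIntegralClosure_bijective_of_smooth (R := R) (S := S)
      (B := K)).2 ⟨x, hx⟩
    obtain rfl : _ = x := congr_arg Subtype.val hy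
    clear hy hx
    induction y with
    | zero => exact ⟨0, by simp⟩
    | add a b ha hb =>
      obtain ⟨a', ha'⟩ := ha
      obtain ⟨b', hb'⟩ := hb
      exact ⟨a' + b', by simp [ha', hb']⟩
    | tmul s r =>
      obtain ⟨r', hr'⟩ := IsIntegrallyClosed.isIntegral_iff.1 r.2
      refine ⟨r' • s, ?_⟩
      simp [TensorProduct.toIntegralClosure, ← hr', Algebra.algebraMap_eq_smul_one (A := K),
        TensorProduct.smul_tmul']
  have : IsField (S ⊗[R] K) := by
    let : Algebra K (S ⊗[R] K) := Algebra.TensorProduct.rightAlgebra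
    have : Algebra.IsIntegral K (K ⊗[R] S) := inferInstance
    have : Algebra.IsIntegral K (S ⊗[R] K) :=
      (Algebra.TensorProduct.commRight R K S).isIntegral_iff.1 ‹_›
    exact isField_of_isIntegral_of_isField' (R := K) (Field.toIsField K)
  let : Field (S ⊗[R] K) := this.toField
  have : FaithfulSMul S (S ⊗[R] K) := (faithfulSMul_iff_algebraMap_injective _ _).2 hinj
  exact IsIntegrallyClosed.of_isIntegrallyClosedIn S (S ⊗[R] K)

instance MvPolynomial.instIsIntegrallyClosed (σ R : Type*) [CommRing R] [IsDomain R]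
    [IsIntegrallyClosed R] :
    IsIntegrallyClosed (MvPolynomial σ R) := by
  let K := FractionRing R
  let := MvPolynomial.algebraMvPolynomial (σ := σ) (R := R) (S := K)
  have hinj : Function.Injective (algebraMap (MvPolynomial σ R) (MvPolynomial σ K)) :=
    MvPolynomial.map_injective _ (IsFractionRing.injective R K)
  have : IsIntegrallyClosedIn (MvPolynomial σ R) (MvPolynomial σ K) := by
    rw [isIntegrallyClosedIn_iff]
    refine ⟨hinj, fun {x} hx ↦ ?_⟩
    rw [MvPolynomial.isIntegral_iff_isIntegral_coeff] at hx
    change x ∈ Set.range (MvPolynomial.map (algebraMap R K))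
    rw [MvPolynomial.mem_range_map_iff_coeffs_subset]
    intro c hc
    obtain ⟨n, -, rfl⟩ := MvPolynomial.mem_coeffs_iff.1 hc
    exact IsIntegrallyClosed.isIntegral_iff.1 (hx n)
  have : FaithfulSMul (MvPolynomial σ R) (MvPolynomial σ K) :=
    (faithfulSMul_iff_algebraMap_injective _ _).2 hinj
  exact .of_isIntegrallyClosed_of_isIntegrallyClosedIn _ (MvPolynomial σ K)

theorem exists_lTensor_eq_of_rTensor_eq_lTensor {k : Type*} [Field k]
    {V V₁ W W₁ : Type*} [AddCommGroup V] [AddCommGroup V₁] [AddCommGroup W] [AddCommGroup W₁]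
    [Module k V] [Module k V₁] [Module k W] [Module k W₁] (f : V →ₗ[k] V₁) (g : W →ₗ[k] W₁)
    (hf : Function.Injective f) (x : V ⊗[k] W₁) (y : V₁ ⊗[k] W)
    (h : f.rTensor W₁ x = g.lTensor V₁ y) :
    ∃ z : V ⊗[k] W, g.lTensor V z = x := by
  have hq : Function.Exact g (LinearMap.range g).mkQ := LinearMap.exact_map_mkQ_range g
  have hs := (LinearMap.range g).mkQ_surjective
  refine (lTensor_exact V hq hs x).1 ?_
  apply Module.Flat.rTensor_preserves_injective_linearMap f hf
  rw [map_zero, ← LinearMap.comp_apply, LinearMap.rTensor_comp_lTensor,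
    ← LinearMap.lTensor_comp_rTensor, LinearMap.comp_apply, h]
  exact (lTensor_exact V₁ hq hs _).2 ⟨y, rfl⟩

theorem isLocalization_fractionRing_tensorProduct (k A F B : Type*) [Field k] [CommRing A]
    [Algebra k A] [Field F]
    [Algebra k F] [Algebra A F] [IsScalarTower k A F] [IsFractionRing A F] [CommRing B]
    [Algebra k B] [Algebra (A ⊗[k] B) (F ⊗[k] B)]
    (h : algebraMap (A ⊗[k] B) (F ⊗[k] B) =
      (Algebra.TensorProduct.map (IsScalarTower.toAlgHom k A F) (AlgHom.id k B)).toRingHom) :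
    IsLocalization (Algebra.algebraMapSubmonoid (A ⊗[k] B) (nonZeroDivisors A)) (F ⊗[k] B) := by
  have : IsScalarTower A (A ⊗[k] B) (F ⊗[k] B) := .of_algebraMap_eq fun x ↦ by simp [h]
  exact IsLocalization.tensorProduct_tensorProduct k B _ F (by ext; simp [h])

section FractionRing

variable (k A F B : Type*) [Field k] [CommRing A] [IsDomain A] [Algebra k A] [Field F]
    [Algebra k F] [Algebra A F] [IsScalarTower k A F] [IsFractionRing A F] [CommRing B]
    [Algebra k B] [IsDomain B] [IsDomain (A ⊗[k] B)]

include A in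
theorem isDomain_fractionRing_tensorProduct : IsDomain (F ⊗[k] B) := by
  let := (Algebra.TensorProduct.map (IsScalarTower.toAlgHom k A F) (AlgHom.id k B)).toAlgebra
  have := isLocalization_fractionRing_tensorProduct k A F B rfl
  exact IsLocalization.isDomain_of_le_nonZeroDivisors _
    (algebraMapSubmonoid_nonZeroDivisors_le (R := A) (S := A ⊗[k] B))

include A in
theorem isIntegrallyClosed_fractionRing_tensorProduct [IsIntegrallyClosed (A ⊗[k] B)] :
    IsIntegrallyClosed (F ⊗[k] B) := by
  let := (Algebra.TensorProduct.map (IsScalarTower.toAlgHom k A F) (AlgHom.id k B)).toAlgebra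
  have := isLocalization_fractionRing_tensorProduct k A F B rfl
  exact isIntegrallyClosed_of_isLocalization (R := A ⊗[k] B) (S := F ⊗[k] B) _
    (algebraMapSubmonoid_nonZeroDivisors_le (R := A) (S := A ⊗[k] B))

variable {k A F B} in
theorem exists_map_eq_of_isIntegralElem [IsIntegrallyClosed (A ⊗[k] B)] {x : F ⊗[k] B}
    (hx : (Algebra.TensorProduct.map (IsScalarTower.toAlgHom k A F)
      (AlgHom.id k B)).toRingHom.IsIntegralElem x) :
    ∃ y, Algebra.TensorProduct.map (IsScalarTower.toAlgHom k A F) (AlgHom.id k B) y = x := by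
  let := (Algebra.TensorProduct.map (IsScalarTower.toAlgHom k A F) (AlgHom.id k B)).toAlgebra
  have := isLocalization_fractionRing_tensorProduct k A F B rfl
  have := IsLocalization.isIntegrallyClosedIn (R := A ⊗[k] B) (S := F ⊗[k] B) _
    (algebraMapSubmonoid_nonZeroDivisors_le (R := A) (S := A ⊗[k] B))
  exact IsIntegrallyClosedIn.isIntegral_iff.1 hx

end FractionRing

theorem isIntegrallyClosed_tensorProduct_of_isSeparable (k F L Z : Type*) [Field k]
    [Field F] [Field L] [Algebra k F] [Algebra F L] [Algebra k L] [IsScalarTower k F L]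
    [Algebra.IsSeparable F L] [Module.Finite F L]
    [CommRing Z] [Algebra k Z] [IsDomain (L ⊗[k] Z)] [IsDomain (F ⊗[k] Z)]
    [IsIntegrallyClosed (F ⊗[k] Z)] : IsIntegrallyClosed (L ⊗[k] Z) := by
  have : Algebra.FormallyEtale F L := .of_isSeparable F L
  have : Algebra.FinitePresentation F L := Algebra.FinitePresentation.of_finiteType.1 inferInstance
  have : Algebra.Etale F L := {}
  let e : (F ⊗[k] Z) ⊗[F] L ≃+* L ⊗[k] Z :=
    (Algebra.TensorProduct.comm F (F ⊗[k] Z) L).toRingEquiv.trans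
      (Algebra.TensorProduct.cancelBaseChange k F F L Z).toRingEquiv
  have : IsDomain ((F ⊗[k] Z) ⊗[F] L) := e.toMulEquiv.isDomain
  have := isIntegrallyClosed_tensorProduct_of_etale F L (F ⊗[k] Z)
  exact .of_equiv e

open scoped IntermediateField.algebraAdjoinAdjoin in
/-- A normal domain over a perfect field stays normal after tensoring with a finitely generated
field extension, provided that the tensor product is a domain. -/
theorem isIntegrallyClosed_tensorProduct_of_perfectField (k L Z : Type*) [Field k]
    [PerfectField k] [Field L] [Algebra k L] [Algebra.EssFiniteType k L]
    [CommRing Z] [Algebra k Z] [IsDomain Z] [IsIntegrallyClosed Z]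
    [IsDomain (L ⊗[k] Z)] : IsIntegrallyClosed (L ⊗[k] Z) := by
  obtain ⟨s, hs, hsep⟩ := exists_isTranscendenceBasis_and_isSeparable_of_perfectField k L
  let e : MvPolynomial s k ⊗[k] Z ≃ₐ[k] Algebra.adjoin k (s : Set L) ⊗[k] Z :=
    Algebra.TensorProduct.congr
      (hs.1.aevalEquiv.trans (Subalgebra.equivOfEq _ _ (by simp))) AlgEquiv.refl
  let e' : MvPolynomial s Z ≃+* Algebra.adjoin k (s : Set L) ⊗[k] Z :=
    ((MvPolynomial.algebraTensorAlgEquiv k Z).symm.toRingEquiv.trans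
      (Algebra.TensorProduct.comm k _ _).toRingEquiv).trans e.toRingEquiv
  have : IsIntegrallyClosed (Algebra.adjoin k (s : Set L) ⊗[k] Z) := .of_equiv e'
  have : IsDomain (Algebra.adjoin k (s : Set L) ⊗[k] Z) := e'.symm.toMulEquiv.isDomain
  have := isDomain_fractionRing_tensorProduct k (Algebra.adjoin k (s : Set L))
    (IntermediateField.adjoin k (s : Set L)) Z
  have := isIntegrallyClosed_fractionRing_tensorProduct k (Algebra.adjoin k (s : Set L))
    (IntermediateField.adjoin k (s : Set L)) Z
  have : Algebra.EssFiniteType (IntermediateField.adjoin k (s : Set L)) L := .of_comp k _ L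
  have : Module.Finite (IntermediateField.adjoin k (s : Set L)) L :=
    Algebra.finite_of_essFiniteType_of_isAlgebraic
  exact isIntegrallyClosed_tensorProduct_of_isSeparable k
    (IntermediateField.adjoin k (s : Set L)) L Z

/-- Over an algebraically closed field `k`, the tensor product of two
finitely generated normal (i.e. integrally closed) commutative domains is again a normal
domain. -/
theorem tensorProduct_normal_domain
    (k : Type*) [Field k] [IsAlgClosed k]
    (Z Z' : Type*) [CommRing Z] [CommRing Z'] [Algebra k Z] [Algebra k Z']
    [IsDomain Z] [IsDomain Z']
    (hfg : Algebra.FiniteType k Z) (hfg' : Algebra.FiniteType k Z')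
    [IsIntegrallyClosed Z] [IsIntegrallyClosed Z'] :
    IsDomain (Z ⊗[k] Z') ∧ IsIntegrallyClosed (Z ⊗[k] Z') := by
  have hdom := isDomain_tensorProduct_of_isAlgClosed k Z Z'
  refine ⟨hdom, ?_⟩
  let K := FractionRing Z
  let L := FractionRing Z'
  have : Algebra.EssFiniteType Z K := .of_isLocalization _ (nonZeroDivisors Z)
  have : Algebra.EssFiniteType Z' L := .of_isLocalization _ (nonZeroDivisors Z')
  have : Algebra.EssFiniteType k K := .comp k Z K
  have : Algebra.EssFiniteType k L := .comp k Z' L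
  have : IsDomain (K ⊗[k] Z') := isDomain_fractionRing_tensorProduct k Z K Z'
  have : IsDomain (Z' ⊗[k] Z) := (Algebra.TensorProduct.comm k Z' Z).toMulEquiv.isDomain
  have : IsDomain (L ⊗[k] Z) := isDomain_fractionRing_tensorProduct k Z' L Z
  have : IsDomain (Z ⊗[k] L) := (Algebra.TensorProduct.comm k Z L).toMulEquiv.isDomain
  have : IsDomain (K ⊗[k] L) := isDomain_fractionRing_tensorProduct k Z K L
  have : IsDomain (Z' ⊗[k] K) := (Algebra.TensorProduct.comm k Z' K).toMulEquiv.isDomain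
  have : IsIntegrallyClosed (K ⊗[k] Z') := isIntegrallyClosed_tensorProduct_of_perfectField k K Z'
  have : IsIntegrallyClosed (Z' ⊗[k] K) := .of_equiv (Algebra.TensorProduct.comm k K Z').toRingEquiv
  have : IsIntegrallyClosed (L ⊗[k] Z) := isIntegrallyClosed_tensorProduct_of_perfectField k L Z
  have : IsIntegrallyClosed (Z ⊗[k] L) := .of_equiv (Algebra.TensorProduct.comm k L Z).toRingEquiv
  have : IsIntegrallyClosed (K ⊗[k] L) := isIntegrallyClosed_tensorProduct_of_perfectField k K L
  let i := IsScalarTower.toAlgHom k Z K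
  let j := IsScalarTower.toAlgHom k Z' L
  let f : Z ⊗[k] Z' →ₐ[k] K ⊗[k] L := Algebra.TensorProduct.map i j
  have hi : Function.Injective i := IsFractionRing.injective Z K
  have hj : Function.Injective j := IsFractionRing.injective Z' L
  have hf : Function.Injective f :=
    TensorProduct.map_injective_of_flat_flat i.toLinearMap j.toLinearMap hi hj
  let := f.toAlgebra
  have : FaithfulSMul (Z ⊗[k] Z') (K ⊗[k] L) := (faithfulSMul_iff_algebraMap_injective _ _).2 hf
  have : IsIntegrallyClosedIn (Z ⊗[k] Z') (K ⊗[k] L) := by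
    rw [isIntegrallyClosedIn_iff]
    refine ⟨hf, fun {x} (hx : f.toRingHom.IsIntegralElem x) ↦ ?_⟩
    let c := Algebra.TensorProduct.comm k K L
    have hfl : f = (Algebra.TensorProduct.map i (.id k L)).comp
        (Algebra.TensorProduct.map (.id k Z) j) := by ext <;> rfl
    have hfr : c.toAlgHom.comp f = (Algebra.TensorProduct.map j (.id k K)).comp
        ((Algebra.TensorProduct.map (.id k Z') i).comp
          (Algebra.TensorProduct.comm k Z Z').toAlgHom) := by ext <;> rfl
    have hxl : ((Algebra.TensorProduct.map i (.id k L)).comp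
        (Algebra.TensorProduct.map (.id k Z) j)).toRingHom.IsIntegralElem x := hfl ▸ hx
    have hxr : ((Algebra.TensorProduct.map j (.id k K)).comp
        ((Algebra.TensorProduct.map (.id k Z') i).comp
          (Algebra.TensorProduct.comm k Z Z').toAlgHom)).toRingHom.IsIntegralElem (c x) :=
      hfr ▸ hx.map c.toAlgHom.toRingHom
    obtain ⟨u, hu⟩ := exists_map_eq_of_isIntegralElem hxl.of_comp
    obtain ⟨v, hv⟩ := exists_map_eq_of_isIntegralElem hxr.of_comp
    have huv : i.toLinearMap.rTensor L u =
        j.toLinearMap.lTensor K (Algebra.TensorProduct.comm k _ _ v) := by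
      apply c.injective
      refine (congr_arg c hu).trans (hv.symm.trans ?_)
      clear hv
      induction v with
      | zero => simp
      | add a b ha hb => simp only [map_add, ha, hb]
      | tmul a b => rfl
    obtain ⟨z, hz⟩ := exists_lTensor_eq_of_rTensor_eq_lTensor _ _ hi _ _ huv
    exact ⟨z, (DFunLike.congr_fun hfl z).trans ((congr_arg _ hz).trans hu)⟩
  exact .of_isIntegrallyClosed_of_isIntegrallyClosedIn _ (K ⊗[k] L)
end

section
/- Let k be a field, let m ≥ 1, and let p₁, …, p_m ∈ k[c] be nonzero polynomials in one variable. Then the quotient ring Z := k[a₁,…,a_m, b₁,…,b_m, c]/(a_ib_i − p_i(c) : 1 ≤ i ≤ m), i.e., the polynomial ring in 2m+1 variables over k modulo the ideal generated by the m elements a_ib_i − p_i(c), is a Noetherian integral domain which is integrally closed in its field of fractions (i.e., Z is a normal domain). -/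
/-- The complete-intersection ring `k[a₁,…,a_m,b₁,…,b_m,c]/(aᵢbᵢ − pᵢ(c) : 1 ≤ i ≤ m)`.
The first `Fin m` summand indexes the variables `aᵢ`, the second indexes the `bᵢ`, and
the `Unit` summand is the variable `c`. -/
abbrev GWACenterRing (k : Type*) [Field k] (m : ℕ) (p : Fin m → Polynomial k) : Type _ :=
  MvPolynomial (Fin m ⊕ Fin m ⊕ Unit) k ⧸
    Ideal.span (Set.range fun i : Fin m =>
      MvPolynomial.X (Sum.inl i) * MvPolynomial.X (Sum.inr (Sum.inl i))
        - Polynomial.aeval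
            (MvPolynomial.X (Sum.inr (Sum.inr ())) : MvPolynomial (Fin m ⊕ Fin m ⊕ Unit) k)
            (p i))

open LaurentPolynomial Polynomial

namespace LaurentPolynomial

variable {R : Type*} [CommRing R]

theorem coeff_mul_T (f : R[T;T⁻¹]) (m n : ℤ) : (f * T m).coeff n = f.coeff (n - m) := by
  refine (AddMonoidAlgebra.coeff_mul_single_eq_coeff_mul (r := 1) (x := f) (n - m) ?_).trans
    (mul_one _)
  exact fun _ _ => eq_sub_iff_add_eq.symm

theorem coeff_C_mul (r : R) (f : R[T;T⁻¹]) (n : ℤ) :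
    (LaurentPolynomial.C r * f).coeff n = r * f.coeff n := by
  rw [← smul_eq_C_mul]; simp

theorem coeff_toLaurent_natCast (f : R[X]) (n : ℕ) : (toLaurent f).coeff n = f.coeff n := by
  rw [coeff_toLaurent]
  exact Finsupp.mapDomain_apply Nat.castEmbedding.injective _ n

theorem coeff_toLaurent_of_neg (f : R[X]) {n : ℤ} (hn : n < 0) : (toLaurent f).coeff n = 0 := by
  rw [coeff_toLaurent]
  refine Finsupp.mapDomain_of_notMem_range _ _ ?_
  rintro ⟨m, rfl⟩
  exact absurd hn (by simp)

theorem isIntegrallyClosed [IsDomain R] [IsIntegrallyClosed R] :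
    IsIntegrallyClosed R[T;T⁻¹] :=
  isIntegrallyClosed_of_isLocalization R[T;T⁻¹] (Submonoid.powers (X : R[X]))
    (powers_le_nonZeroDivisors_of_noZeroDivisors X_ne_zero)

theorem aeval_T_one (f : R[X]) : aeval (T 1 : R[T;T⁻¹]) f = toLaurent f := by
  rw [← toLaurent_X, ← coe_toLaurentAlg, aeval_algHom_apply, aeval_X_left_apply]

/-- The Laurent expansion of `g(r T⁻¹)`. -/
theorem aeval_C_mul_T_neg_one (r : R) (g : R[X]) :
    aeval (LaurentPolynomial.C r * T (-1)) g
      = invert (toLaurent (g.comp (Polynomial.C r * X))) := by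
  induction g using Polynomial.induction_on' with
  | add p q hp hq => simp [hp, hq]
  | monomial n s =>
    simp only [← C_mul_X_pow_eq_monomial, map_mul, map_pow, aeval_C, aeval_X, mul_comp, C_comp,
      pow_comp, X_comp, toLaurent_C, toLaurent_X, invert_C, invert_T, ← C_eq_algebraMap]

end LaurentPolynomial

/-- An element of the fraction field of `S` that is integral over `S` lies in every integrally
closed localization `S_a`. -/
theorem IsIntegral.exists_mul_pow_eq_of_away {S Sa K : Type*} [CommRing S] [IsDomain S]
    [CommRing Sa] [Algebra S Sa] [Field K] [Algebra S K] [IsFractionRing S K]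
    {a : S} (ha : a ≠ 0) [IsLocalization.Away a Sa] [IsIntegrallyClosed Sa]
    {x : K} (hx : IsIntegral S x) :
    ∃ (n : ℕ) (s : S), x * algebraMap S K a ^ n = algebraMap S K s := by
  have hu : IsUnit (algebraMap S K a) := by simpa using ha
  let : Algebra Sa K := (IsLocalization.Away.lift (S := Sa) a hu).toAlgebra
  have : IsScalarTower S Sa K := .of_algebraMap_eq fun s =>
    (IsLocalization.Away.lift_eq a hu s).symm
  have : IsFractionRing Sa K :=
    .isFractionRing_of_isDomain_of_isLocalization (Submonoid.powers a) Sa K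
  obtain ⟨y, rfl⟩ := IsIntegrallyClosed.isIntegral_iff.mp (hx.tower_top (A := Sa))
  obtain ⟨n, s, h⟩ := IsLocalization.Away.surj a y
  exact ⟨n, s, by
    rw [IsScalarTower.algebraMap_apply S Sa K, ← map_pow, ← map_mul, h,
      ← IsScalarTower.algebraMap_apply]⟩

/-- If `a, b` is a regular sequence in a domain `S` and both `S_a` and `S_b` are integrally closed,
then so is `S`. -/
theorem IsIntegrallyClosed.of_away_away {S Sa Sb : Type*} [CommRing S] [IsDomain S]
    [CommRing Sa] [Algebra S Sa] [CommRing Sb] [Algebra S Sb] {a b : S} (ha : a ≠ 0) (hb : b ≠ 0)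
    [IsLocalization.Away a Sa] [IsIntegrallyClosed Sa]
    [IsLocalization.Away b Sb] [IsIntegrallyClosed Sb]
    (hab : ∀ x, a ∣ b * x → a ∣ x) : IsIntegrallyClosed S := by
  have hbpow : ∀ (m : ℕ) (x : S), a ∣ b ^ m * x → a ∣ x := by
    intro m
    induction m with
    | zero => simp
    | succ m ih => exact fun x hx => ih x (hab _ (by rwa [← mul_assoc, ← pow_succ']))
  have hpow : ∀ (n m : ℕ) (x : S), a ^ n ∣ b ^ m * x → a ^ n ∣ x := by
    intro n m
    induction n with
    | zero => simp
    | succ n ih =>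
      intro x hx
      obtain ⟨y, rfl⟩ := ih x ((pow_dvd_pow a n.le_succ).trans hx)
      rw [pow_succ, mul_left_comm, mul_dvd_mul_iff_left (pow_ne_zero n ha)] at hx
      rw [pow_succ]
      exact mul_dvd_mul_left _ (hbpow m y hx)
  refine (isIntegrallyClosed_iff (FractionRing S)).mpr fun {x} hx => ?_
  obtain ⟨n, u, hu⟩ := hx.exists_mul_pow_eq_of_away (Sa := Sa) ha
  obtain ⟨m, v, hv⟩ := hx.exists_mul_pow_eq_of_away (Sa := Sb) hb
  have inj := IsFractionRing.injective S (FractionRing S)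
  have huv : b ^ m * u = a ^ n * v := by
    apply inj
    rw [map_mul, map_mul, ← hu, ← hv, map_pow, map_pow]
    ring
  obtain ⟨s, rfl⟩ := hpow n m u ⟨v, huv⟩
  refine ⟨s, ?_⟩
  have ha' : algebraMap S (FractionRing S) a ^ n ≠ 0 := pow_ne_zero n (by simpa using ha)
  apply mul_right_cancel₀ ha'
  rw [hu, map_mul, map_pow, mul_comm]

section Hyperbola

variable {R S : Type*} [CommRing R] [CommRing S] [Algebra R S] {a b : S} {p : R}

/-- If `S` is generated over `R` by `a` and `b` with `a * b ∈ R`, then every element of `S` is of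
the form `f(a) + b g(b)`. -/
theorem exists_eq_aeval_add_mul_aeval (hab : a * b = algebraMap R S p)
    (hgen : Algebra.adjoin R {a, b} = ⊤) (x : S) :
    ∃ f g : R[X], x = aeval a f + b * aeval b g := by
  have hx : x ∈ Subalgebra.toSubmodule (Algebra.adjoin R {a, b}) := by simp [hgen]
  rw [Algebra.adjoin_eq_span] at hx
  induction hx using Submodule.span_induction with
  | zero => exact ⟨0, 0, by simp⟩
  | add x y _ _ hx hy =>
    obtain ⟨f, g, rfl⟩ := hx
    obtain ⟨f', g', rfl⟩ := hy
    exact ⟨f + f', g + g', by simp only [map_add]; ring⟩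
  | smul r x _ hx =>
    obtain ⟨f, g, rfl⟩ := hx
    exact ⟨r • f, r • g, by simp⟩
  | mem x hx =>
    induction hx using Submonoid.closure_induction_left with
    | one => exact ⟨1, 0, by simp⟩
    | mul_left y hy z _ hz =>
      obtain ⟨f, g, rfl⟩ := hz
      obtain rfl | rfl := hy
      · refine ⟨X * f + Polynomial.C (p * g.coeff 0), Polynomial.C p * g.divX, ?_⟩
        nth_rw 1 [← divX_mul_X_add g]
        simp only [map_add, map_mul, aeval_X, aeval_C, ← hab]
        ring
      · refine ⟨Polynomial.C p * f.divX, X * g + Polynomial.C (f.coeff 0), ?_⟩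
        nth_rw 1 [← divX_mul_X_add f]
        simp only [map_add, map_mul, aeval_X, aeval_C, ← hab]
        ring

variable {φ : S →ₐ[R] R[T;T⁻¹]}

theorem map_aeval_add_mul_aeval (ha : φ a = T 1) (hb : φ b = LaurentPolynomial.C p * T (-1))
    (f g : R[X]) : φ (aeval a f + b * aeval b g)
      = toLaurent f + invert (toLaurent ((X * g).comp (Polynomial.C p * X))) := by
  have hg : b * aeval b g = aeval b (X * g) := by simp
  rw [hg, map_add, ← aeval_algHom_apply, ← aeval_algHom_apply, ha, hb,
    aeval_C_mul_T_neg_one, aeval_T_one]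

theorem coeff_natCast_map (ha : φ a = T 1) (hb : φ b = LaurentPolynomial.C p * T (-1))
    (f g : R[X]) (n : ℕ) : (φ (aeval a f + b * aeval b g)).coeff n = f.coeff n := by
  rw [map_aeval_add_mul_aeval ha hb, AddMonoidAlgebra.coeff_add, Finsupp.add_apply,
    coeff_toLaurent_natCast, invert_apply, add_eq_left]
  rcases n with _ | n
  · have := coeff_toLaurent_natCast ((X * g).comp (Polynomial.C p * X)) 0
    rw [comp_C_mul_X_coeff] at this
    simpa using this
  · exact coeff_toLaurent_of_neg _ (by lia)

theorem coeff_neg_map (ha : φ a = T 1) (hb : φ b = LaurentPolynomial.C p * T (-1))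
    (f g : R[X]) (n : ℕ) :
    (φ (aeval a f + b * aeval b g)).coeff (-(n + 1)) = p ^ (n + 1) * g.coeff n := by
  rw [map_aeval_add_mul_aeval ha hb, AddMonoidAlgebra.coeff_add, Finsupp.add_apply,
    coeff_toLaurent_of_neg _ (by lia), zero_add, invert_apply, neg_neg, ← Nat.cast_succ,
    coeff_toLaurent_natCast, comp_C_mul_X_coeff, coeff_X_mul, mul_comm]

theorem isLocalization_away_of_eq_T (hφ : Function.Injective φ) (ha : φ a = T 1) :
    letI := φ.toRingHom.toAlgebra
    IsLocalization.Away a R[T;T⁻¹] := by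
  let := φ.toRingHom.toAlgebra
  have hmap : ∀ s, algebraMap S R[T;T⁻¹] s = φ s := fun _ => rfl
  refine ⟨?_, ?_, ?_⟩
  · rintro ⟨_, n, rfl⟩
    simp only [hmap, map_pow, ha]
    exact (isUnit_T 1).pow n
  · intro F
    obtain ⟨n, f, hf⟩ := exists_T_pow F
    refine ⟨⟨aeval a f, a ^ n, n, rfl⟩, ?_⟩
    simp only [hmap, map_pow, ha, ← aeval_algHom_apply, T_pow, mul_one, aeval_T_one, hf]
  · intro x y hxy
    exact ⟨1, by rw [hφ hxy]⟩

variable [IsDomain R]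

theorem injective_of_eq_T (hp : p ≠ 0) (hab : a * b = algebraMap R S p)
    (hgen : Algebra.adjoin R {a, b} = ⊤)
    (ha : φ a = T 1) (hb : φ b = LaurentPolynomial.C p * T (-1)) : Function.Injective φ := by
  refine (injective_iff_map_eq_zero φ).mpr fun x hx => ?_
  obtain ⟨f, g, rfl⟩ := exists_eq_aeval_add_mul_aeval hab hgen x
  have hf : f = 0 := by
    ext n
    rw [← coeff_natCast_map ha hb f g, hx]
    simp
  have hg : g = 0 := by
    ext n
    have := coeff_neg_map ha hb f g n
    rw [hx] at this
    simpa [hp] using this.symm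
  simp [hf, hg]

theorem dvd_of_dvd_mul_of_eq_T (hp : p ≠ 0) (hab : a * b = algebraMap R S p)
    (hgen : Algebra.adjoin R {a, b} = ⊤)
    (ha : φ a = T 1) (hb : φ b = LaurentPolynomial.C p * T (-1)) (x : S) (hx : a ∣ b * x) :
    a ∣ x := by
  obtain ⟨z, hz⟩ := hx
  have hcoeff : ∀ n : ℤ, p * (φ x).coeff (n + 2) = (φ z).coeff n := by
    intro n
    have h := congrArg (fun s => (φ s).coeff (n + 1)) hz
    simp only [map_mul, ha, hb, T_mul, mul_assoc, LaurentPolynomial.coeff_C_mul, coeff_mul_T] at h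
    convert h using 3 <;> ring_nf
  obtain ⟨f, g, rfl⟩ := exists_eq_aeval_add_mul_aeval hab hgen x
  obtain ⟨u, v, rfl⟩ := exists_eq_aeval_add_mul_aeval hab hgen z
  have hf : f.coeff 0 = p * v.coeff 1 := by
    have h := hcoeff (-2)
    have h1 := coeff_natCast_map ha hb f g 0
    have h2 := coeff_neg_map ha hb u v 1
    norm_num at h h1 h2
    rw [h1, h2] at h
    apply mul_left_cancel₀ hp
    rw [h]
    ring
  have hg : g = Polynomial.C p * v.divX.divX := by
    ext n
    have h := hcoeff (-((n + 2 : ℕ) + 1))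
    rw [coeff_neg_map ha hb, show -(((n + 2 : ℕ) : ℤ) + 1) + 2 = -((n : ℤ) + 1) by push_cast; ring,
      coeff_neg_map ha hb] at h
    rw [Polynomial.coeff_C_mul, coeff_divX, coeff_divX]
    apply mul_left_cancel₀ (pow_ne_zero (n + 2) hp)
    linear_combination h
  refine ⟨aeval a f.divX + b * algebraMap R S (v.coeff 1) + b ^ 2 * aeval b v.divX.divX, ?_⟩
  rw [hg]
  nth_rw 1 [← divX_mul_X_add f]
  simp only [hf, map_add, map_mul, aeval_X, aeval_C, ← hab]
  ring

/-- If `R` is a normal domain and `p ≠ 0`, then `R[a, b] / (a b - p)` is a normal domain. The ring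
is given here as an `R`-algebra generated by `a` and `b` with `a b = p`, having both Laurent
polynomial rings `R[a, a⁻¹]` and `R[b, b⁻¹]` as targets. -/
theorem isDomain_and_isIntegrallyClosed_of_eq_T [IsIntegrallyClosed R] (hp : p ≠ 0)
    (hab : a * b = algebraMap R S p) (hgen : Algebra.adjoin R {a, b} = ⊤) {ψ : S →ₐ[R] R[T;T⁻¹]}
    (hφa : φ a = T 1) (hφb : φ b = LaurentPolynomial.C p * T (-1))
    (hψa : ψ a = LaurentPolynomial.C p * T (-1)) (hψb : ψ b = T 1) :
    IsDomain S ∧ IsIntegrallyClosed S := by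
  have hφ := injective_of_eq_T hp hab hgen hφa hφb
  have hψ := injective_of_eq_T hp (by rwa [mul_comm]) (by rwa [Set.pair_comm]) hψb hψa
  have hS : IsDomain S := hφ.isDomain φ.toRingHom
  have hT : (T 1 : R[T;T⁻¹]) ≠ 0 := (isUnit_T 1).ne_zero
  refine ⟨hS, ?_⟩
  have := isLocalization_away_of_eq_T hφ hφa
  have := isLocalization_away_of_eq_T hψ hψb
  have := LaurentPolynomial.isIntegrallyClosed (R := R)
  exact @IsIntegrallyClosed.of_away_away S R[T;T⁻¹] R[T;T⁻¹] _ _ _ φ.toRingHom.toAlgebra _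
    ψ.toRingHom.toAlgebra a b (fun h => hT (by rw [← hφa, h, map_zero]))
    (fun h => hT (by rw [← hψb, h, map_zero])) ‹_› _ ‹_› _
    (dvd_of_dvd_mul_of_eq_T hp hab hgen hφa hφb)

end Hyperbola

/-- A type synonym of `GWACenterRing`, so that unification does not unfold
it to a quotient of a polynomial ring. -/
def GWACenter (k : Type*) [Field k] (m : ℕ) (p : Fin m → k[X]) : Type _ :=
  GWACenterRing k m p

namespace GWACenter

variable {k : Type*} [Field k] {m : ℕ}

noncomputable instance (p : Fin m → k[X]) : CommRing (GWACenter k m p) :=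
  inferInstanceAs (CommRing (GWACenterRing k m p))

noncomputable instance (p : Fin m → k[X]) : Algebra k (GWACenter k m p) :=
  inferInstanceAs (Algebra k (GWACenterRing k m p))

/-- The quotient map from the polynomial ring. -/
noncomputable def mk (p : Fin m → k[X]) :
    MvPolynomial (Fin m ⊕ Fin m ⊕ Unit) k →ₐ[k] GWACenter k m p :=
  Ideal.Quotient.mkₐ k _

theorem mk_surjective (p : Fin m → k[X]) : Function.Surjective (mk p) :=
  Ideal.Quotient.mk_surjective

/-- The class of `aᵢ`. -/
noncomputable def a (p : Fin m → k[X]) (i : Fin m) : GWACenter k m p :=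
  mk p (MvPolynomial.X (Sum.inl i))

/-- The class of `bᵢ`. -/
noncomputable def b (p : Fin m → k[X]) (i : Fin m) : GWACenter k m p :=
  mk p (MvPolynomial.X (Sum.inr (Sum.inl i)))

/-- The class of `c`. -/
noncomputable def c (p : Fin m → k[X]) : GWACenter k m p :=
  mk p (MvPolynomial.X (Sum.inr (Sum.inr ())))

theorem aeval_c (p : Fin m → k[X]) (f : k[X]) :
    aeval (c p) f = mk p (aeval (MvPolynomial.X (Sum.inr (Sum.inr ()))) f) :=
  aeval_algHom_apply (mk p) _ f

theorem a_mul_b (p : Fin m → k[X]) (i : Fin m) : a p i * b p i = aeval (c p) (p i) := by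
  rw [aeval_c, a, b, ← map_mul]
  exact Ideal.Quotient.eq.mpr (Ideal.subset_span ⟨i, rfl⟩)

section lift

variable {p : Fin m → k[X]} {A : Type*} [CommRing A] [Algebra k A] (α β : Fin m → A) (γ : A)
  (h : ∀ i, α i * β i = aeval γ (p i))

/-- The universal property of `GWACenter k m p`. -/
noncomputable def lift : GWACenter k m p →ₐ[k] A :=
  Ideal.Quotient.liftₐ _ (MvPolynomial.aeval (Sum.elim α (Sum.elim β fun _ => γ))) fun x hx => by
    rw [← RingHom.mem_ker]
    refine Ideal.span_le.mpr ?_ hx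
    rintro _ ⟨i, rfl⟩
    simp [RingHom.mem_ker, ← aeval_algHom_apply, h]

@[simp] theorem lift_a (i : Fin m) : lift α β γ h (a p i) = α i :=
  MvPolynomial.aeval_X _ _

@[simp] theorem lift_b (i : Fin m) : lift α β γ h (b p i) = β i :=
  MvPolynomial.aeval_X _ _

@[simp] theorem lift_c : lift α β γ h (c p) = γ :=
  MvPolynomial.aeval_X _ _

end lift

variable {p : Fin m → k[X]}

theorem adjoin_eq_top : Algebra.adjoin k (Set.range (a p) ∪ Set.range (b p) ∪ {c p}) = ⊤ := by
  refine eq_top_iff.mpr fun x _ => ?_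
  obtain ⟨q, rfl⟩ := mk_surjective p x
  induction q using MvPolynomial.induction_on with
  | C r =>
    rw [← MvPolynomial.algebraMap_eq, AlgHom.commutes]
    exact Subalgebra.algebraMap_mem _ r
  | add q r hq hr => exact by simpa only [map_add] using add_mem (hq trivial) (hr trivial)
  | mul_X q i hq =>
    rw [map_mul]
    refine mul_mem (hq trivial) (Algebra.subset_adjoin ?_)
    obtain i | i | i := i
    · exact .inl (.inl ⟨i, rfl⟩)
    · exact .inl (.inr ⟨i, rfl⟩)
    · exact .inr rfl

theorem algHom_ext {A : Type*} [Semiring A] [Algebra k A] {f g : GWACenter k m p →ₐ[k] A}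
    (ha : ∀ i, f (a p i) = g (a p i)) (hb : ∀ i, f (b p i) = g (b p i))
    (hc : f (c p) = g (c p)) : f = g := by
  refine AlgHom.ext_of_adjoin_eq_top adjoin_eq_top ?_
  rintro _ ((⟨i, rfl⟩ | ⟨i, rfl⟩) | rfl)
  exacts [ha i, hb i, hc]

theorem a_succ_mul_b_succ (p : Fin (m + 1) → k[X]) (i : Fin m) :
    a p i.succ * b p i.succ = aeval (c p) (Fin.tail p i) :=
  a_mul_b p i.succ

/-- The inclusion of the ring on the last `m` pairs of generators. -/
noncomputable def succHom (p : Fin (m + 1) → k[X]) :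
    GWACenter k m (Fin.tail p) →ₐ[k] GWACenter k (m + 1) p :=
  lift (p := Fin.tail p) (fun i => a p i.succ) (fun i => b p i.succ) (c p) (a_succ_mul_b_succ p)

@[simp] theorem succHom_a (p : Fin (m + 1) → k[X]) (i : Fin m) :
    succHom p (a _ i) = a p i.succ :=
  lift_a ..

@[simp] theorem succHom_b (p : Fin (m + 1) → k[X]) (i : Fin m) :
    succHom p (b _ i) = b p i.succ :=
  lift_b ..

@[simp] theorem succHom_c (p : Fin (m + 1) → k[X]) : succHom p (c _) = c p :=
  lift_c ..

section extend

variable {p : Fin (m + 1) → k[X]} {A : Type*} [CommRing A] [Algebra k A]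
  (f : GWACenter k m (Fin.tail p) →ₐ[k] A) (x y : A)
  (h : x * y = f (aeval (c (Fin.tail p)) (p 0)))

/-- Extension of a homomorphism along `succHom` by prescribing the images of the first pair of
generators. -/
noncomputable def extend : GWACenter k (m + 1) p →ₐ[k] A :=
  lift (Fin.cons x fun i => f (a _ i)) (Fin.cons y fun i => f (b _ i)) (f (c _)) <| Fin.cases
    (by simpa [aeval_algHom_apply] using h)
    (fun i => by simp [← map_mul, a_mul_b, aeval_algHom_apply, Fin.tail])

theorem extend_comp_succHom : (extend f x y h).comp (succHom p) = f :=
  algHom_ext (by simp [extend]) (by simp [extend]) (by simp [extend])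

@[simp] theorem extend_a_zero : extend f x y h (a p 0) = x := by simp [extend]

@[simp] theorem extend_b_zero : extend f x y h (b p 0) = y := by simp [extend]

end extend

section Algebra

variable (p : Fin (m + 1) → k[X])

/-- The ring on `m + 1` pairs of generators as an algebra over the one on the last `m` pairs. -/
noncomputable abbrev algebraSucc :
    Algebra (GWACenter k m (Fin.tail p)) (GWACenter k (m + 1) p) :=
  (succHom p).toRingHom.toAlgebra

attribute [local instance] algebraSucc

theorem algebraMap_eq_succHom (r : GWACenter k m (Fin.tail p)) :
    algebraMap _ (GWACenter k (m + 1) p) r = succHom p r := rfl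

theorem isScalarTower_succ :
    IsScalarTower k (GWACenter k m (Fin.tail p)) (GWACenter k (m + 1) p) :=
  .of_algebraMap_eq fun r => ((succHom p).commutes r).symm

theorem a_zero_mul_b_zero :
    a p 0 * b p 0
      = algebraMap (GWACenter k m (Fin.tail p)) _ (aeval (c (Fin.tail p)) (p 0)) := by
  rw [a_mul_b, algebraMap_eq_succHom, ← aeval_algHom_apply]
  simp

theorem adjoin_pair_eq_top :
    Algebra.adjoin (GWACenter k m (Fin.tail p)) {a p 0, b p 0} = ⊤ := by
  have := isScalarTower_succ p
  set A := Algebra.adjoin (GWACenter k m (Fin.tail p)) {a p 0, b p 0}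
  have ha : a p 0 ∈ A := Algebra.subset_adjoin (Set.mem_insert _ _)
  have hb : b p 0 ∈ A := Algebra.subset_adjoin (Set.mem_insert_of_mem _ (Set.mem_singleton _))
  have hs (r) : succHom p r ∈ A := A.algebraMap_mem r
  clear_value A
  have h : Algebra.adjoin k (Set.range (a p) ∪ Set.range (b p) ∪ {c p})
      ≤ A.restrictScalars k := by
    refine Algebra.adjoin_le fun x hx => (Subalgebra.mem_restrictScalars k).mpr ?_
    obtain (⟨i, rfl⟩ | ⟨i, rfl⟩) | rfl := hx
    · exact Fin.cases ha (fun i => succHom_a p i ▸ hs _) i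
    · exact Fin.cases hb (fun i => succHom_b p i ▸ hs _) i
    · exact succHom_c p ▸ hs _
  rw [adjoin_eq_top] at h
  exact eq_top_iff.mpr fun x _ => h trivial

/-- `extend` for a target that is an algebra over the ring on the last `m` pairs. -/
noncomputable def extendₐ {A : Type*} [CommRing A] [Algebra k A]
    [Algebra (GWACenter k m (Fin.tail p)) A]
    [IsScalarTower k (GWACenter k m (Fin.tail p)) A] (x y : A)
    (h : x * y = algebraMap (GWACenter k m (Fin.tail p)) A (aeval (c (Fin.tail p)) (p 0))) :
    GWACenter k (m + 1) p →ₐ[GWACenter k m (Fin.tail p)] A where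
  __ := (extend (IsScalarTower.toAlgHom k _ A) x y h).toRingHom
  commutes' r := DFunLike.congr_fun (extend_comp_succHom (IsScalarTower.toAlgHom k _ A) x y h) r

theorem isDomain_and_isIntegrallyClosed_and_injective_succ
    [IsDomain (GWACenter k m (Fin.tail p))] [IsIntegrallyClosed (GWACenter k m (Fin.tail p))]
    (hinj : Function.Injective (aeval (R := k) (c (Fin.tail p)))) (hp : p 0 ≠ 0) :
    IsDomain (GWACenter k (m + 1) p) ∧ IsIntegrallyClosed (GWACenter k (m + 1) p) ∧
      Function.Injective (aeval (R := k) (c p)) := by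
  have hq : aeval (c (Fin.tail p)) (p 0) ≠ 0 := fun h => hp (hinj (by simpa using h))
  generalize hqdef : aeval (c (Fin.tail p)) (p 0) = q at hq
  have hab := a_zero_mul_b_zero p
  rw [hqdef] at hab
  have hφ : T 1 * (LaurentPolynomial.C q * T (-1)) = LaurentPolynomial.C q := by
    rw [T_mul, mul_assoc, ← T_add]
    simp
  have hψ : LaurentPolynomial.C q * T (-1) * T 1 = LaurentPolynomial.C q := by
    rw [← T_mul, hφ]
  rw [LaurentPolynomial.C_eq_algebraMap q] at hφ hψ
  subst hqdef
  let φ := extendₐ p _ _ hφ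
  let ψ := extendₐ p _ _ hψ
  obtain ⟨hS, hS'⟩ := isDomain_and_isIntegrallyClosed_of_eq_T hq hab (adjoin_pair_eq_top p)
    (φ := φ) (ψ := ψ) (extend_a_zero _ _ _ hφ) (extend_b_zero _ _ _ hφ)
    (extend_a_zero _ _ _ hψ) (extend_b_zero _ _ _ hψ)
  refine ⟨hS, hS', fun f g hfg => hinj ?_⟩
  apply FaithfulSMul.algebraMap_injective (GWACenter k m (Fin.tail p))
    (GWACenter k m (Fin.tail p))[T;T⁻¹]
  have h (f : k[X]) : φ (algebraMap _ _ (aeval (c (Fin.tail p)) f)) = φ (aeval (c p) f) := by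
    rw [algebraMap_eq_succHom, ← aeval_algHom_apply]
    simp
  rw [← φ.commutes, ← φ.commutes, h, h, hfg]

end Algebra

theorem isDomain_and_isIntegrallyClosed_and_injective (p : Fin m → k[X]) (hp : ∀ i, p i ≠ 0) :
    IsDomain (GWACenter k m p) ∧ IsIntegrallyClosed (GWACenter k m p) ∧
      Function.Injective (aeval (R := k) (c p)) := by
  induction m with
  | zero =>
    let e : GWACenter k 0 p ≃ₐ[k] k[X] := .ofAlgHom
      (lift Fin.elim0 Fin.elim0 X fun i => i.elim0) (aeval (c p))
      (by ext; simp) (algHom_ext (fun i => i.elim0) (fun i => i.elim0) (by simp))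
    exact ⟨e.toMulEquiv.isDomain, .of_equiv e.symm.toRingEquiv, e.symm.injective⟩
  | succ m ih =>
    obtain ⟨_, _, hinj⟩ := ih (Fin.tail p) fun i => hp i.succ
    exact isDomain_and_isIntegrallyClosed_and_injective_succ p hinj (hp 0)

end GWACenter

/-- For any field `k`, `m ≥ 1`, and nonzero polynomials
`p₁, …, p_m ∈ k[c]`, the ring `Z = k[a₁,…,a_m,b₁,…,b_m,c]/(aᵢbᵢ − pᵢ(c))` is a Noetherian
integral domain which is integrally closed in its field of fractions (a normal domain). -/
theorem gwaCenterRing_noetherian_normal_domain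
    (k : Type*) [Field k] (m : ℕ) (hm : 1 ≤ m) (p : Fin m → Polynomial k)
    (hp : ∀ i, p i ≠ 0) :
    IsNoetherianRing (GWACenterRing k m p) ∧ IsDomain (GWACenterRing k m p) ∧
      IsIntegrallyClosed (GWACenterRing k m p) := by
  obtain ⟨hdom, hint, -⟩ := GWACenter.isDomain_and_isIntegrallyClosed_and_injective p hp
  exact ⟨inferInstance, hdom, hint⟩
end

section
/- Assume q is a root of unity and h ∉ k (h is nonconstant). (1) If q² ≠ 1, then a k-algebra endomorphism φ of W is a k-algebra automorphism of W if and only if there exist α, β, γ ∈ k^× with h(γt) = αβ·h(t) in k[t] such that φ(x) = αx, φ(y) = βy, and φ(t) = γt. (2) If q = −1, then a k-algebra endomorphism φ of W is a k-algebra automorphism of W if and only if either it has the form in (1), or there exist α, β, γ ∈ k^× with h(γt) = αβ·h(−t) in k[t] such that φ(x) = αy, φ(y) = βx, and φ(t) = γt. -/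
/-- Generators of the degree `m` quantum generalized Weyl algebra:
`x i`, `y i` for `i : Fin m`, and `t`. -/
inductive GWAGen (m : ℕ) : Type
  | x : Fin m → GWAGen m
  | y : Fin m → GWAGen m
  | t : GWAGen m

/-- The defining relations of the degree `m` quantum generalized Weyl algebra over `k`
with parameters `q : Fin m → k` and `h : Fin m → k[X]`:
`xᵢt = qᵢ·txᵢ`, `yᵢt = qᵢ⁻¹·tyᵢ`, `xᵢyᵢ = hᵢ(t)`, `yᵢxᵢ = hᵢ(qᵢ⁻¹t)`, and
`xᵢ`, `yᵢ` commute with `xⱼ`, `yⱼ` for `i ≠ j`. -/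
inductive GWARel (k : Type*) [Field k] (m : ℕ) (q : Fin m → k) (h : Fin m → Polynomial k) :
    FreeAlgebra k (GWAGen m) → FreeAlgebra k (GWAGen m) → Prop
  | xt (i : Fin m) : GWARel k m q h
      (FreeAlgebra.ι k (GWAGen.x i) * FreeAlgebra.ι k GWAGen.t)
      (q i • (FreeAlgebra.ι k GWAGen.t * FreeAlgebra.ι k (GWAGen.x i)))
  | yt (i : Fin m) : GWARel k m q h
      (FreeAlgebra.ι k (GWAGen.y i) * FreeAlgebra.ι k GWAGen.t)
      ((q i)⁻¹ • (FreeAlgebra.ι k GWAGen.t * FreeAlgebra.ι k (GWAGen.y i)))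
  | xy (i : Fin m) : GWARel k m q h
      (FreeAlgebra.ι k (GWAGen.x i) * FreeAlgebra.ι k (GWAGen.y i))
      (Polynomial.aeval (FreeAlgebra.ι k GWAGen.t) (h i))
  | yx (i : Fin m) : GWARel k m q h
      (FreeAlgebra.ι k (GWAGen.y i) * FreeAlgebra.ι k (GWAGen.x i))
      (Polynomial.aeval ((q i)⁻¹ • FreeAlgebra.ι k GWAGen.t) (h i))
  | xx (i j : Fin m) (hij : i ≠ j) : GWARel k m q h
      (FreeAlgebra.ι k (GWAGen.x i) * FreeAlgebra.ι k (GWAGen.x j))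
      (FreeAlgebra.ι k (GWAGen.x j) * FreeAlgebra.ι k (GWAGen.x i))
  | yy (i j : Fin m) (hij : i ≠ j) : GWARel k m q h
      (FreeAlgebra.ι k (GWAGen.y i) * FreeAlgebra.ι k (GWAGen.y j))
      (FreeAlgebra.ι k (GWAGen.y j) * FreeAlgebra.ι k (GWAGen.y i))
  | xyc (i j : Fin m) (hij : i ≠ j) : GWARel k m q h
      (FreeAlgebra.ι k (GWAGen.x i) * FreeAlgebra.ι k (GWAGen.y j))
      (FreeAlgebra.ι k (GWAGen.y j) * FreeAlgebra.ι k (GWAGen.x i))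

/-- The degree `m` quantum generalized Weyl algebra `k[t](x, y, σ, h)` with `σᵢ(t) = qᵢt`:
the quotient of the free algebra on the generators by the two-sided ideal generated by
the defining relations. -/
abbrev GWA (k : Type*) [Field k] (m : ℕ) (q : Fin m → k) (h : Fin m → Polynomial k) : Type _ :=
  RingQuot (GWARel k m q h)

variable {k : Type*} [Field k] {m : ℕ} {q : Fin m → k} {h : Fin m → Polynomial k}

/-- The generator `xᵢ` of the quantum GWA. -/
noncomputable def GWA.x (i : Fin m) : GWA k m q h :=
  RingQuot.mkAlgHom k (GWARel k m q h) (FreeAlgebra.ι k (GWAGen.x i))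

/-- The generator `yᵢ` of the quantum GWA. -/
noncomputable def GWA.y (i : Fin m) : GWA k m q h :=
  RingQuot.mkAlgHom k (GWARel k m q h) (FreeAlgebra.ι k (GWAGen.y i))

/-- The generator `t` of the quantum GWA. -/
noncomputable def GWA.t : GWA k m q h :=
  RingQuot.mkAlgHom k (GWARel k m q h) (FreeAlgebra.ι k GWAGen.t)

/-- The quantum GWA is an algebra over its center. -/
noncomputable instance GWA.algebraCenter :
    Algebra (Subalgebra.center k (GWA k m q h)) (GWA k m q h) :=
  RingHom.toAlgebra' (Subalgebra.center k (GWA k m q h)).val.toRingHom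
    (fun c x => by
      have := Subalgebra.mem_center_iff.mp c.2 x
      simpa using this.symm)

open Polynomial

namespace GWA

section Polynomial

variable {K : Type*} [Field K]

theorem comp_C_mul_X_comp_C_mul_X (p : K[X]) (a b : K) :
    (p.comp (C a * X)).comp (C b * X) = p.comp (C (a * b) * X) := by
  simp [comp_assoc, mul_assoc]

theorem comp_C_one_mul_X (p : K[X]) : p.comp (C 1 * X) = p := by simp

theorem natDegree_comp_C_mul_X (p : K[X]) {a : K} (ha : a ≠ 0) :
    (p.comp (C a * X)).natDegree = p.natDegree := by
  rw [natDegree_comp, natDegree_C_mul_X a ha, mul_one]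

theorem comp_C_mul_X_eq_zero_iff {p : K[X]} {a : K} (ha : a ≠ 0) :
    p.comp (C a * X) = 0 ↔ p = 0 := by
  refine ⟨fun h => ?_, fun h => by simp [h]⟩
  rw [← comp_C_one_mul_X p, ← mul_inv_cancel₀ ha, ← comp_C_mul_X_comp_C_mul_X, h, zero_comp]

theorem aeval_smul_eq_aeval_comp {B : Type*} [Semiring B] [Algebra K B] (c : K) (b : B) (p : K[X]) :
    aeval (c • b) p = aeval b (p.comp (C c * X)) := by
  rw [aeval_comp]
  simp [Algebra.smul_def]

theorem mul_aeval_of_mul_eq_smul {B : Type*} [Semiring B] [Algebra K B] {c : K} {u b : B}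
    (hub : u * b = c • (b * u)) (p : K[X]) :
    u * aeval b p = aeval b (p.comp (C c * X)) * u := by
  rw [← aeval_smul_eq_aeval_comp]
  induction p using Polynomial.induction_on' with
  | add p r hp hr => simp [mul_add, add_mul, hp, hr]
  | monomial n a =>
    have hpow : ∀ n : ℕ, u * b ^ n = (c • b) ^ n * u := by
      intro n
      induction n with
      | zero => simp
      | succ n ih =>
        rw [pow_succ, ← mul_assoc, ih, mul_assoc, hub, pow_succ, mul_assoc, smul_mul_assoc]
    simp only [aeval_monomial]
    rw [← mul_assoc, ← Algebra.commutes a u, mul_assoc, hpow, mul_assoc]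

end Polynomial

variable {K : Type*} [Field K] {q₀ : K} {h₀ : K[X]}

local notation "W" => GWA K 1 (fun _ => q₀) (fun _ => h₀)

section Presentation

theorem x_mul_t : (x 0 : W) * t = q₀ • (t * x 0) := by
  simpa [x, t] using
    RingQuot.mkAlgHom_rel K (GWARel.xt (q := fun _ => q₀) (h := fun _ => h₀) (0 : Fin 1))

theorem y_mul_t : (y 0 : W) * t = q₀⁻¹ • (t * y 0) := by
  simpa [y, t] using
    RingQuot.mkAlgHom_rel K (GWARel.yt (q := fun _ => q₀) (h := fun _ => h₀) (0 : Fin 1))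

theorem x_mul_y : (x 0 : W) * y 0 = aeval t h₀ := by
  have := RingQuot.mkAlgHom_rel K (GWARel.xy (q := fun _ => q₀) (h := fun _ => h₀) (0 : Fin 1))
  rwa [map_mul, ← aeval_algHom_apply] at this

theorem y_mul_x : (y 0 : W) * x 0 = aeval t (h₀.comp (C q₀⁻¹ * X)) := by
  have := RingQuot.mkAlgHom_rel K (GWARel.yx (q := fun _ => q₀) (h := fun _ => h₀) (0 : Fin 1))
  rwa [map_mul, ← aeval_algHom_apply, map_smul, aeval_smul_eq_aeval_comp] at this

variable {B : Type*} [Ring B] [Algebra K B]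

theorem exists_algHom (a b c : B) (hac : a * c = q₀ • (c * a)) (hbc : b * c = q₀⁻¹ • (c * b))
    (hab : a * b = aeval c h₀) (hba : b * a = aeval c (h₀.comp (C q₀⁻¹ * X))) :
    ∃ f : W →ₐ[K] B, f (x 0) = a ∧ f (y 0) = b ∧ f t = c := by
  let g : FreeAlgebra K (GWAGen 1) →ₐ[K] B := FreeAlgebra.lift K fun
    | .x _ => a
    | .y _ => b
    | .t => c
  refine ⟨RingQuot.liftAlgHom K ⟨g, fun u v huv => ?_⟩, ?_⟩
  · induction huv with
    | xt i => simpa [g] using hac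
    | yt i => simpa [g] using hbc
    | xy i => simpa [g, ← aeval_algHom_apply] using hab
    | yx i => simpa [g, ← aeval_algHom_apply, aeval_smul_eq_aeval_comp] using hba
    | xx i j hij => exact absurd (Subsingleton.elim i j) hij
    | yy i j hij => exact absurd (Subsingleton.elim i j) hij
    | xyc i j hij => exact absurd (Subsingleton.elim i j) hij
  · simp [x, y, t, g]

theorem eq_top_of_mem {S : Subalgebra K W} (hx : x 0 ∈ S) (hy : y 0 ∈ S) (ht : t ∈ S) :
    S = ⊤ := by
  have h : ∀ w : FreeAlgebra K (GWAGen 1), RingQuot.mkAlgHom K _ w ∈ S := by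
    intro w
    induction w with
    | grade0 r => rw [AlgHom.commutes]; exact S.algebraMap_mem r
    | grade1 g =>
      match g with
      | .x i => rw [Subsingleton.elim i 0]; exact hx
      | .y i => rw [Subsingleton.elim i 0]; exact hy
      | .t => exact ht
    | mul a b ha hb => rw [map_mul]; exact S.mul_mem ha hb
    | add a b ha hb => rw [map_add]; exact S.add_mem ha hb
  refine top_unique fun w _ => ?_
  obtain ⟨w, rfl⟩ := RingQuot.mkAlgHom_surjective K _ w
  exact h w

theorem algHom_ext {f g : W →ₐ[K] B} (hx : f (x 0) = g (x 0)) (hy : f (y 0) = g (y 0))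
    (ht : f t = g t) : f = g :=
  AlgHom.ext fun w => by
    have := eq_top_of_mem (S := AlgHom.equalizer f g) hx hy ht
    exact (AlgHom.mem_equalizer f g w).1 (this ▸ Algebra.mem_top)

end Presentation

section NormalForm

/-- The homogeneous generator of degree `i`: `x ^ i` if `0 ≤ i`, and `y ^ (-i)` otherwise. -/
noncomputable def z : ℤ → W
  | .ofNat n => x 0 ^ n
  | .negSucc n => y 0 ^ (n + 1)

theorem z_zero : z 0 = (1 : W) := pow_zero _

theorem z_one : z 1 = (x 0 : W) := pow_one _

theorem z_neg_one : z (-1) = (y 0 : W) := pow_one _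

theorem x_mul_z (i : ℤ) : ∃ e : K[X], (x 0 : W) * z i = aeval t e * z (i + 1) := by
  match i with
  | .ofNat n => exact ⟨1, by rw [map_one, one_mul]; exact (pow_succ' (x 0 : W) n).symm⟩
  | .negSucc 0 => exact ⟨h₀, by simpa [z_zero, z] using x_mul_y⟩
  | .negSucc (n + 1) =>
    refine ⟨h₀, ?_⟩
    rw [show Int.negSucc (n + 1) + 1 = Int.negSucc n by omega]
    simp only [z]
    rw [pow_succ' _ (n + 1), ← mul_assoc, x_mul_y]

theorem y_mul_z (i : ℤ) : ∃ e : K[X], (y 0 : W) * z i = aeval t e * z (i - 1) := by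
  match i with
  | .ofNat 0 => exact ⟨1, by simp [z_zero, z_neg_one]⟩
  | .ofNat (n + 1) =>
    refine ⟨h₀.comp (C q₀⁻¹ * X), ?_⟩
    rw [show Int.ofNat (n + 1) - 1 = Int.ofNat n by simp]
    simp only [z]
    rw [pow_succ', ← mul_assoc, y_mul_x]
  | .negSucc n =>
    refine ⟨1, ?_⟩
    rw [show Int.negSucc n - 1 = Int.negSucc (n + 1) by omega]
    simp only [z]
    rw [pow_succ' _ (n + 1), map_one, one_mul]

/-- The element of the algebra with prescribed polynomial coefficients in front of the `z i`. -/
noncomputable def ofCoeffs : (ℤ →₀ K[X]) →ₗ[K] W :=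
  Finsupp.lsum K fun i => LinearMap.mulRight K (z i) ∘ₗ (aeval t).toLinearMap

theorem ofCoeffs_apply (F : ℤ →₀ K[X]) :
    ofCoeffs F = F.sum fun i f => aeval t f * (z i : W) := rfl

theorem ofCoeffs_single (i : ℤ) (f : K[X]) :
    ofCoeffs (Finsupp.single i f) = aeval t f * (z i : W) := by
  simp [ofCoeffs_apply]

theorem t_mul_ofCoeffs (F : ℤ →₀ K[X]) : t * ofCoeffs F = (ofCoeffs ((X : K[X]) • F) : W) := by
  induction F using Finsupp.induction_linear with
  | zero => simp
  | add F G hF hG => rw [map_add, mul_add, hF, hG, smul_add, map_add]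
  | single i f =>
    rw [Finsupp.smul_single, smul_eq_mul, ofCoeffs_single, ofCoeffs_single, map_mul, aeval_X,
      mul_assoc]

theorem ofCoeffs_surjective : Function.Surjective (ofCoeffs : (ℤ →₀ K[X]) →ₗ[K] W) := by
  let S : Subalgebra K W :=
    { carrier := {w | ∀ v ∈ LinearMap.range (ofCoeffs : (ℤ →₀ K[X]) →ₗ[K] W),
        w * v ∈ LinearMap.range (ofCoeffs : (ℤ →₀ K[X]) →ₗ[K] W)}
      mul_mem' := fun ha hb v hv => by rw [mul_assoc]; exact ha _ (hb _ hv)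
      add_mem' := fun ha hb v hv => by rw [add_mul]; exact add_mem (ha v hv) (hb v hv)
      algebraMap_mem' := fun r v hv => by
        rw [← Algebra.smul_def]; exact Submodule.smul_mem _ r hv }
  have key : ∀ (u : W) (c : K) (s : ℤ), u * t = c • (t * u) →
      (∀ i, ∃ e : K[X], u * z i = aeval t e * z (i + s)) → u ∈ S := by
    rintro u c s hu hz _ ⟨F, rfl⟩
    induction F using Finsupp.induction_linear with
    | zero => simp
    | add F G hF hG => rw [map_add, mul_add]; exact add_mem hF hG
    | single i f =>
      obtain ⟨e, he⟩ := hz i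
      refine ⟨Finsupp.single (i + s) (f.comp (C c * X) * e), ?_⟩
      rw [ofCoeffs_single, ofCoeffs_single, ← mul_assoc, mul_aeval_of_mul_eq_smul hu, mul_assoc, he,
        map_mul, mul_assoc]
  have hS : S = ⊤ := eq_top_of_mem (key _ q₀ 1 x_mul_t x_mul_z) (key _ q₀⁻¹ (-1) y_mul_t y_mul_z)
    (by rintro _ ⟨F, rfl⟩; exact ⟨_, (t_mul_ofCoeffs F).symm⟩)
  intro w
  have hw : w ∈ S := hS ▸ Algebra.mem_top
  have := hw 1 ⟨Finsupp.single 0 1, by simp [ofCoeffs_single, z_zero]⟩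
  rwa [mul_one] at this

end NormalForm

section Grading

/-- The polynomial `d` for which `z i = d(t) * x ^ i` once `x` is made invertible. -/
noncomputable def leadingFactor (q₀ : K) (h₀ : K[X]) : ℤ → K[X]
  | .ofNat _ => 1
  | .negSucc n => ∏ j ∈ Finset.range (n + 1), h₀.comp (C ((q₀⁻¹) ^ (j + 1)) * X)

theorem leadingFactor_zero : leadingFactor q₀ h₀ 0 = 1 := rfl

theorem leadingFactor_one : leadingFactor q₀ h₀ 1 = 1 := rfl

theorem leadingFactor_neg_one : leadingFactor q₀ h₀ (-1) = h₀.comp (C q₀⁻¹ * X) := by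
  change ∏ j ∈ Finset.range (0 + 1), h₀.comp (C ((q₀⁻¹) ^ (j + 1)) * X) = _
  rw [zero_add, Finset.prod_range_one, zero_add, pow_one]

theorem leadingFactor_ne_zero (hq : q₀ ≠ 0) (hh : h₀ ≠ 0) (i : ℤ) :
    leadingFactor q₀ h₀ i ≠ 0 := by
  match i with
  | .ofNat n => exact one_ne_zero
  | .negSucc n =>
    exact Finset.prod_ne_zero_iff.2 fun j _ =>
      (comp_C_mul_X_eq_zero_iff (pow_ne_zero _ (inv_ne_zero hq))).not.2 hh

theorem not_isUnit_leadingFactor (hq : q₀ ≠ 0) (hh : 1 ≤ h₀.natDegree) {i : ℤ} (hi : i < 0) :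
    ¬ IsUnit (leadingFactor q₀ h₀ i) := by
  match i with
  | .ofNat n => exact absurd hi (by simp)
  | .negSucc n =>
    intro hu
    have := natDegree_eq_zero_of_isUnit
      (isUnit_of_dvd_unit (Finset.dvd_prod_of_mem _ (Finset.mem_range.2 n.succ_pos)) hu)
    rw [natDegree_comp_C_mul_X _ (pow_ne_zero _ (inv_ne_zero hq))] at this
    omega

/-- The action of the algebra on `ℤ`-indexed families of polynomials, thought of as skew Laurent
polynomials in `x`. -/
theorem exists_laurentAction (hq : q₀ ≠ 0) :
    ∃ ρ : W →ₐ[K] Module.End K (ℤ → K[X]), ∀ (F : ℤ →₀ K[X]) (G : ℤ → K[X]) (j : ℤ),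
      ρ (ofCoeffs F) G j = F.sum fun i f =>
        f * leadingFactor q₀ h₀ i * (G (j - i)).comp (C (q₀ ^ i) * X) := by
  let τ : Module.End K (ℤ → K[X]) :=
    { toFun := fun G j => X * G j
      map_add' := fun F G => by ext1 j; simp [mul_add]
      map_smul' := fun c G => by ext1 j; simp }
  let ξ : Module.End K (ℤ → K[X]) :=
    { toFun := fun G j => (G (j - 1)).comp (C q₀ * X)
      map_add' := fun F G => by ext1 j; simp
      map_smul' := fun c G => by ext1 j; simp }
  let η : Module.End K (ℤ → K[X]) :=
    { toFun := fun G j => h₀.comp (C q₀⁻¹ * X) * (G (j + 1)).comp (C q₀⁻¹ * X)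
      map_add' := fun F G => by ext1 j; simp [mul_add]
      map_smul' := fun c G => by ext1 j; simp }
  have hτ : ∀ (p : K[X]) (G : ℤ → K[X]) (j : ℤ), aeval τ p G j = p * G j := by
    intro p G j
    induction p using Polynomial.induction_on' with
    | add p r hp hr => simp [add_mul, hp, hr]
    | monomial n a =>
      have hpow : ∀ n : ℕ, (τ ^ n) G j = X ^ n * G j := by
        intro n
        induction n with
        | zero => simp
        | succ n ih =>
          rw [pow_succ', pow_succ', mul_assoc, ← ih]
          rfl
      rw [aeval_monomial, ← C_mul_X_pow_eq_monomial, mul_assoc, ← hpow, ← smul_eq_C_mul]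
      rfl
  obtain ⟨ρ, hx, hy, ht⟩ := exists_algHom (q₀ := q₀) (h₀ := h₀) ξ η τ
    (by ext1 G; ext1 j; simp [ξ, τ, mul_assoc, smul_eq_C_mul])
    (by ext1 G; ext1 j; simp [η, τ, smul_eq_C_mul]; ring)
    (by
      ext1 G; ext1 j
      rw [hτ]
      simp [ξ, η, comp_C_mul_X_comp_C_mul_X, hq])
    (by
      ext1 G; ext1 j
      rw [hτ]
      simp [ξ, η, comp_C_mul_X_comp_C_mul_X, hq])
  refine ⟨ρ, fun F G j => ?_⟩
  have hz : ∀ (i : ℤ) (G : ℤ → K[X]) (j : ℤ), ρ (z i) G j =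
      leadingFactor q₀ h₀ i * (G (j - i)).comp (C (q₀ ^ i) * X) := by
    intro i
    match i with
    | .ofNat n =>
      simp only [z, leadingFactor, map_pow ρ, hx, one_mul, Int.ofNat_eq_natCast, zpow_natCast]
      induction n with
      | zero => simp
      | succ n ih =>
        intro G j
        rw [pow_succ, Module.End.mul_apply, ih]
        simp only [ξ, LinearMap.coe_mk, AddHom.coe_mk, comp_C_mul_X_comp_C_mul_X, ← pow_succ']
        congr 2
        push_cast; ring_nf
    | .negSucc n =>
      simp only [z, leadingFactor, map_pow ρ, hy, zpow_negSucc]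
      induction n with
      | zero => intro G j; simp [η]
      | succ n ih =>
        intro G j
        rw [pow_succ, Module.End.mul_apply, ih, Finset.prod_range_succ _ (n + 1)]
        simp only [η, LinearMap.coe_mk, AddHom.coe_mk, comp_C_mul_X_comp_C_mul_X, mul_comp]
        rw [mul_assoc, ← inv_pow, ← inv_pow, ← pow_succ',
          show j - Int.negSucc n + 1 = j - Int.negSucc (n + 1) by omega]
  induction F using Finsupp.induction_linear with
  | zero => simp
  | add F G hF hG =>
    rw [map_add, map_add, Finsupp.sum_add_index' (by simp) (by intros; ring), ← hF, ← hG]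
    rfl
  | single i f =>
    rw [ofCoeffs_single, map_mul, Module.End.mul_apply, ← aeval_algHom_apply, ht, hτ, hz,
      Finsupp.sum_single_index (by simp), mul_assoc]

theorem exists_laurentAction_apply_single_zero_one (hq : q₀ ≠ 0) :
    ∃ ρ : W →ₐ[K] Module.End K (ℤ → K[X]), (∀ (F : ℤ →₀ K[X]) (G : ℤ → K[X]) (j : ℤ),
      ρ (ofCoeffs F) G j = F.sum fun i f =>
        f * leadingFactor q₀ h₀ i * (G (j - i)).comp (C (q₀ ^ i) * X)) ∧
      ∀ (F : ℤ →₀ K[X]) (j : ℤ),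
        ρ (ofCoeffs F) (Pi.single 0 1) j = F j * leadingFactor q₀ h₀ j := by
  obtain ⟨ρ, hρ⟩ := exists_laurentAction (h₀ := h₀) hq
  refine ⟨ρ, hρ, fun F j => ?_⟩
  rw [hρ, Finsupp.sum, Finset.sum_eq_single j]
  · simp
  · intro i _ hij
    rw [Pi.single_eq_of_ne (sub_ne_zero.2 hij.symm), zero_comp, mul_zero]
  · intro hj
    rw [Finsupp.notMem_support_iff.1 hj, zero_mul, zero_mul]

theorem ofCoeffs_injective (hq : q₀ ≠ 0) (hh : h₀ ≠ 0) :
    Function.Injective (ofCoeffs : (ℤ →₀ K[X]) →ₗ[K] W) := by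
  obtain ⟨ρ, -, hρ⟩ := exists_laurentAction_apply_single_zero_one (h₀ := h₀) hq
  intro F G hFG
  ext1 j
  have := hρ F j
  rw [hFG, hρ] at this
  exact (mul_right_cancel₀ (leadingFactor_ne_zero hq hh j) this).symm

/-- Factors of a nonzero element of degree zero are homogeneous. -/
theorem eq_single_of_mul_eq_aeval (hq : q₀ ≠ 0) (hh : h₀ ≠ 0) {F G : ℤ →₀ K[X]} {p : K[X]}
    (hp : p ≠ 0) (hFG : (ofCoeffs F * ofCoeffs G : W) = aeval t p) :
    ∃ (i : ℤ) (f g : K[X]), F = Finsupp.single i f ∧ G = Finsupp.single (-i) g ∧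
      f * leadingFactor q₀ h₀ i *
        (g * leadingFactor q₀ h₀ (-i)).comp (C (q₀ ^ i) * X) = p := by
  obtain ⟨ρ, hρ, hρ₁⟩ := exists_laurentAction_apply_single_zero_one (h₀ := h₀) hq
  have hmul : ∀ j : ℤ, (F.sum fun i f => f * leadingFactor q₀ h₀ i *
      (G (j - i) * leadingFactor q₀ h₀ (j - i)).comp (C (q₀ ^ i) * X)) =
        Finsupp.single 0 p j * leadingFactor q₀ h₀ j := by
    intro j
    rw [← hρ₁, ofCoeffs_single, z_zero, mul_one, ← hFG, map_mul, Module.End.mul_apply, hρ]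
    simp only [hρ₁]
  have huniq : ∀ a b : ℤ, a ∈ F.support → b ∈ G.support → UniqueAdd F.support G.support a b →
      b = -a ∧ F a * leadingFactor q₀ h₀ a *
        (G b * leadingFactor q₀ h₀ b).comp (C (q₀ ^ a) * X) = p := by
    intro a b ha hb hab
    have h := hmul (a + b)
    rw [Finsupp.sum, Finset.sum_eq_single a] at h
    · rw [add_sub_cancel_left] at h
      have hne : F a * leadingFactor q₀ h₀ a *
          (G b * leadingFactor q₀ h₀ b).comp (C (q₀ ^ a) * X) ≠ 0 := by
        refine mul_ne_zero (mul_ne_zero (Finsupp.mem_support_iff.1 ha)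
          (leadingFactor_ne_zero hq hh _)) ?_
        rw [Ne, comp_C_mul_X_eq_zero_iff (zpow_ne_zero _ hq)]
        exact mul_ne_zero (Finsupp.mem_support_iff.1 hb) (leadingFactor_ne_zero hq hh _)
      have hab0 : a + b = 0 := by
        by_contra hab0
        rw [Finsupp.single_eq_of_ne hab0, zero_mul] at h
        exact hne h
      rw [hab0, Finsupp.single_eq_same, leadingFactor_zero, mul_one] at h
      exact ⟨by omega, h⟩
    · intro i hi hia
      rw [Finsupp.notMem_support_iff.1 fun hmem => hia (hab hi hmem (by omega)).1, zero_mul,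
        zero_comp, mul_zero]
    · exact fun h => absurd ha h
  have hF : F ≠ 0 := by
    rintro rfl
    have := hmul 0
    simp [leadingFactor_zero, eq_comm, hp] at this
  have hG : G ≠ 0 := by
    rintro rfl
    have := hmul 0
    simp [leadingFactor_zero, eq_comm, hp] at this
  have hF' := Finset.card_pos.2 (Finsupp.support_nonempty_iff.2 hF)
  have hG' := Finset.card_pos.2 (Finsupp.support_nonempty_iff.2 hG)
  have hcard : ¬ 1 < F.support.card * G.support.card := by
    intro hcard
    obtain ⟨⟨a, b⟩, h₁, ⟨a', b'⟩, h₂, hne, hu₁, hu₂⟩ :=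
      TwoUniqueSums.uniqueAdd_of_one_lt_card hcard
    rw [Finset.mem_product] at h₁ h₂
    have e₁ := (huniq a b h₁.1 h₁.2 hu₁).1
    have e₂ := (huniq a' b' h₂.1 h₂.2 hu₂).1
    have := hu₁ h₂.1 h₂.2 (by simp only; omega)
    exact hne (Prod.ext this.1.symm this.2.symm)
  have hF1 : F.support.card = 1 := by nlinarith
  have hG1 : G.support.card = 1 := by nlinarith
  obtain ⟨a, f, hf, rfl⟩ := Finsupp.card_support_eq_one'.1 hF1
  obtain ⟨b, g, hg, rfl⟩ := Finsupp.card_support_eq_one'.1 hG1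
  obtain ⟨rfl, h⟩ := huniq a b (by simp [hf]) (by simp [hg]) (by
    intro i j hi hj _
    exact ⟨Finset.mem_singleton.1 (Finsupp.support_single_subset hi),
      Finset.mem_singleton.1 (Finsupp.support_single_subset hj)⟩)
  exact ⟨a, f, g, rfl, rfl, by simpa using h⟩

end Grading

section ModT

/-- The characters of the algebra modulo `t` with values in Laurent polynomials. -/
theorem exists_laurentCharacter (a b : K) (hab : a * b = h₀.eval 0) :
    ∃ (ψ : W →ₐ[K] LaurentPolynomial K) (c : ℤ → K),
      (∀ F j, (ψ (ofCoeffs F)).coeff j = (F j).eval 0 * c j) ∧ ψ t = 0 ∧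
      (∀ i, ψ (z i) = AddMonoidAlgebra.single i (c i)) ∧
      (∀ n : ℕ, c n = a ^ n) ∧ ∀ n : ℕ, c (-n) = b ^ n := by
  have haeval : ∀ p : K[X], aeval (0 : LaurentPolynomial K) p =
      AddMonoidAlgebra.single 0 (p.eval 0) := by
    intro p
    have := aeval_algebraMap_apply (LaurentPolynomial K) (0 : K) p
    rwa [map_zero, LaurentPolynomial.algebraMap_apply, coe_aeval_eq_eval] at this
  obtain ⟨ψ, hx, hy, ht⟩ := exists_algHom (q₀ := q₀) (h₀ := h₀)
    (AddMonoidAlgebra.single 1 a : LaurentPolynomial K) (AddMonoidAlgebra.single (-1) b) 0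
    (by simp) (by simp)
    (by rw [haeval, AddMonoidAlgebra.single_mul_single, hab, add_neg_cancel])
    (by rw [haeval, AddMonoidAlgebra.single_mul_single, mul_comm b, hab]; simp)
  let c : ℤ → K
    | .ofNat n => a ^ n
    | .negSucc n => b ^ (n + 1)
  have hz : ∀ i, ψ (z i) = AddMonoidAlgebra.single i (c i) := by
    intro i
    match i with
    | .ofNat n =>
      simp only [z, c, map_pow, hx, AddMonoidAlgebra.single_pow]
      congr 1
      simp
    | .negSucc n =>
      simp only [z, c, map_pow, hy, AddMonoidAlgebra.single_pow]
      congr 1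
      rw [Int.negSucc_eq]
      simp
  refine ⟨ψ, c, fun F j => ?_, ht, hz, fun n => rfl, fun n => ?_⟩
  · induction F using Finsupp.induction_linear with
    | zero => simp
    | add F G hF hG => simp [hF, hG, add_mul]
    | single i f =>
      rw [ofCoeffs_single, map_mul, hz, ← aeval_algHom_apply, ht, haeval,
        AddMonoidAlgebra.single_mul_single, zero_add, AddMonoidAlgebra.coeff_single]
      by_cases hij : j = i
      · subst hij; simp
      · simp [Finsupp.single_eq_of_ne hij]
  · match n with
    | 0 => simp [c]
    | n + 1 => rfl

theorem transcendental_single_one {i : ℤ} (hi : i ≠ 0) :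
    Transcendental K (AddMonoidAlgebra.single i 1 : LaurentPolynomial K) := by
  refine transcendental_iff.2 fun p hp => ?_
  have hcoeff : ∀ (p : K[X]) (n : ℕ),
      (aeval (AddMonoidAlgebra.single i 1 : LaurentPolynomial K) p).coeff (n * i) = p.coeff n := by
    intro p n
    induction p using Polynomial.induction_on' with
    | add p r hp hr => simp only [map_add, AddMonoidAlgebra.coeff_add, Finsupp.add_apply, hp, hr,
        coeff_add]
    | monomial m a =>
      rw [aeval_monomial, AddMonoidAlgebra.single_pow, one_pow, LaurentPolynomial.algebraMap_apply,
        ← LaurentPolynomial.single_eq_C, AddMonoidAlgebra.single_mul_single, zero_add, mul_one,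
        AddMonoidAlgebra.coeff_single, coeff_monomial, Finsupp.single_apply]
      simp [hi]
  ext n
  rw [← hcoeff, hp]
  simp

/-- A homomorphism to a commutative domain whose image contains a transcendental element
annihilates `t`. -/
theorem map_apply_t_eq_zero {R : Type*} [CommRing R] [IsDomain R] [Algebra K R] (hq : q₀ ≠ 1)
    (hh : h₀ ≠ 0) (f : W →ₐ[K] R) {r : R} (hr : Transcendental K r) (hf : r ∈ f.range) :
    f t = 0 := by
  by_contra ht
  have hx : f (x 0) = 0 := by
    have h := congrArg f (x_mul_t (q₀ := q₀) (h₀ := h₀))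
    rw [map_mul, map_smul, map_mul, Algebra.smul_def] at h
    have h' : (1 - algebraMap K R q₀) * (f t * f (x 0)) = 0 := by linear_combination h
    refine ((mul_eq_zero.1 ((mul_eq_zero.1 h').resolve_left ?_)).resolve_left ht)
    rw [← map_one (algebraMap K R), ← map_sub]
    exact (map_ne_zero_iff _ (FaithfulSMul.algebraMap_injective K R)).2 (sub_ne_zero.2 hq.symm)
  have hy : f (y 0) = 0 := by
    have h := congrArg f (y_mul_t (q₀ := q₀) (h₀ := h₀))
    rw [map_mul, map_smul, map_mul, Algebra.smul_def] at h
    have h' : (1 - algebraMap K R q₀⁻¹) * (f t * f (y 0)) = 0 := by linear_combination h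
    refine ((mul_eq_zero.1 ((mul_eq_zero.1 h').resolve_left ?_)).resolve_left ht)
    rw [← map_one (algebraMap K R), ← map_sub]
    exact (map_ne_zero_iff _ (FaithfulSMul.algebraMap_injective K R)).2
      (sub_ne_zero.2 (inv_ne_one.2 hq).symm)
  have hroot : aeval (f t) h₀ = 0 := by
    rw [aeval_algHom_apply, ← x_mul_y, map_mul, hx, zero_mul]
  have htop : (integralClosure K R).comap f = ⊤ := by
    refine eq_top_of_mem ?_ ?_ ?_
    · simp [Subalgebra.mem_comap, hx]
    · simp [Subalgebra.mem_comap, hy]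
    · exact isAlgebraic_iff_isIntegral.1 ⟨h₀, hh, hroot⟩
  obtain ⟨w, rfl⟩ := hf
  have hw : w ∈ (integralClosure K R).comap f := htop ▸ Algebra.mem_top
  exact hr (isAlgebraic_iff_isIntegral.2 hw)

/-- The image of `t` under a surjective endomorphism is divisible by `t`. -/
theorem exists_apply_t_eq (hq : q₀ ≠ 1) (hh : h₀ ≠ 0) {φ : W →ₐ[K] W}
    (hφ : Function.Surjective φ) : ∃ F : ℤ →₀ K[X], φ t = ofCoeffs ((X : K[X]) • F) := by
  obtain ⟨G, hG⟩ := ofCoeffs_surjective (φ t)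
  have key : ∀ (a b : K), a * b = h₀.eval 0 → ∀ i : ℤ, i ≠ 0 →
      (∀ c : ℤ → K, (∀ n : ℕ, c n = a ^ n) → (∀ n : ℕ, c (-n) = b ^ n) → c i = 1) →
      ∀ j : ℤ, (∀ c : ℤ → K, (∀ n : ℕ, c n = a ^ n) → (∀ n : ℕ, c (-n) = b ^ n) → c j = 1) →
      (G j).eval 0 = 0 := by
    intro a b hab i hi hci j hcj
    obtain ⟨ψ, c, hψ, -, hz, ha, hb⟩ := exists_laurentCharacter (q₀ := q₀) a b hab
    have h := map_apply_t_eq_zero hq hh (ψ.comp φ) (transcendental_single_one hi) (by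
      obtain ⟨w, hw⟩ := hφ (z i)
      exact ⟨w, by simp [hw, hz, hci c ha hb]⟩)
    have h' := hψ G j
    rw [hG, hcj c ha hb, mul_one] at h'
    rw [← h', ← AlgHom.comp_apply, h]
    rfl
  have hG0 : ∀ j, (G j).eval 0 = 0 := by
    intro j
    rcases Int.eq_nat_or_neg j with ⟨n, rfl | rfl⟩
    · refine key 1 (h₀.eval 0) (one_mul _) 1 one_ne_zero (fun c h _ => ?_) _ fun c h _ => ?_
      · simpa using h 1
      · simpa using h n
    · refine key (h₀.eval 0) 1 (mul_one _) (-1) (by simp) (fun c _ h => ?_) _ fun c _ h => ?_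
      · simpa using h 1
      · simpa using h n
  refine ⟨G.mapRange divX divX_zero, ?_⟩
  rw [← hG]
  congr 1
  ext1 j
  rw [Finsupp.smul_apply, Finsupp.mapRange_apply, smul_eq_mul]
  have := X_mul_divX_add (G j)
  rw [coeff_zero_eq_eval_zero, hG0, map_zero, add_zero] at this
  exact this.symm

end ModT

section Automorphisms

/-- Automorphisms rescale `t`. -/
theorem exists_apply_t_eq_smul (hq0 : q₀ ≠ 0) (hq1 : q₀ ≠ 1) (hh : 1 ≤ h₀.natDegree)
    {φ : W →ₐ[K] W} (hφ : Function.Bijective φ) : ∃ γ : Kˣ, φ t = (γ : K) • t := by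
  have hh0 : h₀ ≠ 0 := by rintro rfl; simp at hh
  let e := AlgEquiv.ofBijective φ hφ
  obtain ⟨F, hF⟩ := exists_apply_t_eq hq1 hh0 hφ.2
  obtain ⟨G', hG'⟩ := exists_apply_t_eq hq1 hh0 (φ := (e.symm : W →ₐ[K] W)) e.symm.surjective
  obtain ⟨G, hG⟩ := ofCoeffs_surjective (φ (ofCoeffs G'))
  have hFG : (ofCoeffs ((X : K[X]) • F) * ofCoeffs G : W) = aeval t (X : K[X]) := by
    rw [← hF, hG, ← map_mul, t_mul_ofCoeffs, ← hG', aeval_X]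
    exact e.apply_symm_apply t
  obtain ⟨i, f, g, hFi, -, hfg⟩ := eq_single_of_mul_eq_aeval hq0 hh0 X_ne_zero hFG
  have hf : f = X * F i := by
    rw [← smul_eq_mul, ← Finsupp.smul_apply, hFi, Finsupp.single_eq_same]
  rw [hf, mul_assoc X, mul_assoc X, mul_right_eq_self₀, or_iff_left X_ne_zero, mul_comp] at hfg
  have hu := IsUnit.of_mul_eq_one _ hfg
  have hi : i = 0 := by
    rcases lt_trichotomy i 0 with hi | hi | hi
    · exact absurd (isUnit_of_mul_isUnit_right hu) (not_isUnit_leadingFactor hq0 hh hi)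
    · exact hi
    · refine absurd ?_ (not_isUnit_leadingFactor hq0 hh (neg_lt_zero.2 hi))
      have hu' := isUnit_of_mul_isUnit_right (IsUnit.of_mul_eq_one_right _ hfg)
      have := hu'.map (compRingHom (C (q₀ ^ i)⁻¹ * X))
      simpa only [coe_compRingHom_apply, comp_C_mul_X_comp_C_mul_X,
        mul_inv_cancel₀ (zpow_ne_zero i hq0), comp_C_one_mul_X] using this
  subst hi
  obtain ⟨γ, hγ, hγF⟩ := Polynomial.isUnit_iff.1 (isUnit_of_mul_isUnit_left hu)
  refine ⟨hγ.unit, ?_⟩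
  rw [hF, hFi, ofCoeffs_single, z_zero, mul_one, hf, ← hγF, mul_comm, ← smul_eq_C_mul, map_smul,
    aeval_X, IsUnit.unit_spec]

theorem eq_one_or_neg_one_of_surjective {φ : W →ₐ[K] W} (hφ : Function.Surjective φ) {i : ℤ}
    {γ : K} {f g : K[X]} (ht : φ t = γ • t) (hx : φ (x 0) = aeval t f * z i)
    (hy : φ (y 0) = aeval t g * z (-i)) : i = 1 ∨ i = -1 := by
  obtain ⟨ψ, c, hψ, hψt, hz, hc, -⟩ := exists_laurentCharacter (q₀ := q₀) 1 (h₀.eval 0) (one_mul _)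
  let μ : LaurentPolynomial K →ₐ[K] LaurentPolynomial K :=
    AddMonoidAlgebra.mapDomainAlgHom K K (AddMonoidHom.mulLeft i)
  have hμ : ∀ (p : K[X]) (e : ℤ), ψ (aeval t p * z (i * e)) ∈ μ.range := by
    intro p e
    rw [map_mul, ← aeval_algHom_apply, hψt, hz, ← map_zero (algebraMap K _), aeval_algebraMap_apply]
    refine mul_mem (Subalgebra.algebraMap_mem _ _) ⟨AddMonoidAlgebra.single e (c (i * e)), ?_⟩
    exact AddMonoidAlgebra.mapDomain_single
  have htop : μ.range.comap (ψ.comp φ) = ⊤ := by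
    refine eq_top_of_mem ?_ ?_ ?_
    · have := hμ f 1
      rwa [mul_one, ← hx] at this
    · have := hμ g (-1)
      rwa [mul_neg_one, ← hy] at this
    · simp [Subalgebra.mem_comap, ht, hψt]
  obtain ⟨w, hw⟩ := hφ (z 1)
  have hwmem : w ∈ μ.range.comap (ψ.comp φ) := htop ▸ Algebra.mem_top
  obtain ⟨r, hr⟩ := hwmem
  by_contra hi
  have hnot : (1 : ℤ) ∉ Set.range (AddMonoidHom.mulLeft i) := by
    rintro ⟨e, he⟩
    exact hi (Int.isUnit_iff.1 (IsUnit.of_mul_eq_one e he))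
  have h0 : (μ r).coeff 1 = 0 := Finsupp.mapDomain_of_notMem_range _ _ hnot
  have hc1 : c 1 = 1 := by simpa using hc 1
  have h1 : μ r = AddMonoidAlgebra.single 1 1 := by
    rw [← hc1, ← hz, ← hw]
    exact hr
  simp [h1] at h0

theorem exists_eq_of_bijective (hq0 : q₀ ≠ 0) (hq1 : q₀ ≠ 1) (hh : 1 ≤ h₀.natDegree)
    {φ : W →ₐ[K] W} (hφ : Function.Bijective φ) :
    (∃ α β γ : Kˣ, h₀.comp (C (γ : K) * X) = C ((α : K) * (β : K)) * h₀ ∧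
      φ (x 0) = (α : K) • x 0 ∧ φ (y 0) = (β : K) • y 0 ∧ φ t = (γ : K) • t) ∨
    (q₀ ^ 2 = 1 ∧ ∃ α β γ : Kˣ,
      h₀.comp (C (γ : K) * X) = C ((α : K) * (β : K)) * h₀.comp (C q₀⁻¹ * X) ∧
      φ (x 0) = (α : K) • y 0 ∧ φ (y 0) = (β : K) • x 0 ∧ φ t = (γ : K) • t) := by
  have hh0 : h₀ ≠ 0 := by rintro rfl; simp at hh
  obtain ⟨γ, hγ⟩ := exists_apply_t_eq_smul hq0 hq1 hh hφ
  obtain ⟨F, hF⟩ := ofCoeffs_surjective (φ (x 0))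
  obtain ⟨G, hG⟩ := ofCoeffs_surjective (φ (y 0))
  have hFG : (ofCoeffs F * ofCoeffs G : W) = aeval t (h₀.comp (C (γ : K) * X)) := by
    rw [hF, hG, ← map_mul, x_mul_y, ← aeval_algHom_apply, hγ, aeval_smul_eq_aeval_comp]
  obtain ⟨i, f, g, rfl, rfl, hfg⟩ := eq_single_of_mul_eq_aeval hq0 hh0
    ((comp_C_mul_X_eq_zero_iff γ.ne_zero).not.2 hh0) hFG
  rw [ofCoeffs_single] at hF hG
  have hconst : ∀ p : K[X], p.natDegree = h₀.natDegree → ∀ c : K, c ≠ 0 →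
      f * g.comp (C c * X) * p = h₀.comp (C (γ : K) * X) →
      ∃ α β : Kˣ, f = C (α : K) ∧ g = C (β : K) ∧
        h₀.comp (C (γ : K) * X) = C ((α : K) * (β : K)) * p := by
    intro p hp c hc h
    have hne : f * g.comp (C c * X) * p ≠ 0 := by
      rw [h]
      exact (comp_C_mul_X_eq_zero_iff γ.ne_zero).not.2 hh0
    have hp0 := right_ne_zero_of_mul hne
    have hf0 := left_ne_zero_of_mul (left_ne_zero_of_mul hne)
    have hg0 := right_ne_zero_of_mul (left_ne_zero_of_mul hne)
    have hdeg := congrArg natDegree h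
    rw [natDegree_mul (mul_ne_zero hf0 hg0) hp0, natDegree_mul hf0 hg0,
      natDegree_comp_C_mul_X _ hc, natDegree_comp_C_mul_X _ γ.ne_zero, hp] at hdeg
    obtain ⟨a, rfl⟩ := natDegree_eq_zero.1 (show f.natDegree = 0 by omega)
    obtain ⟨b, rfl⟩ := natDegree_eq_zero.1 (show g.natDegree = 0 by omega)
    rw [C_comp] at hg0 h
    exact ⟨Units.mk0 a (by simpa using hf0), Units.mk0 b (by simpa using hg0), rfl, rfl,
      by rw [← h, C_mul]; rfl⟩
  rcases eq_one_or_neg_one_of_surjective hφ.2 hγ hF.symm hG.symm with rfl | rfl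
  · left
    rw [leadingFactor_one, leadingFactor_neg_one, zpow_one, mul_comp, comp_C_mul_X_comp_C_mul_X,
      inv_mul_cancel₀ hq0, comp_C_one_mul_X, mul_one, ← mul_assoc] at hfg
    obtain ⟨α, β, rfl, rfl, h⟩ := hconst _ rfl _ hq0 hfg
    refine ⟨α, β, γ, h, ?_, ?_, hγ⟩
    · rw [← hF, z_one, aeval_C, Algebra.smul_def]
    · rw [← hG, z_neg_one, aeval_C, Algebra.smul_def]
  · right
    rw [neg_neg, leadingFactor_one, leadingFactor_neg_one, mul_one, mul_right_comm] at hfg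
    obtain ⟨α, β, rfl, rfl, h⟩ := hconst _ (natDegree_comp_C_mul_X _ (inv_ne_zero hq0)) _
      (zpow_ne_zero _ hq0) hfg
    rw [aeval_C, ← Algebra.smul_def, z_neg_one] at hF
    rw [neg_neg, aeval_C, ← Algebra.smul_def, z_one] at hG
    refine ⟨?_, α, β, γ, h, hF.symm, hG.symm, hγ⟩
    have h1 := congrArg φ (x_mul_t (q₀ := q₀) (h₀ := h₀))
    rw [map_mul, map_smul, map_mul, ← hF, hγ, smul_mul_smul_comm, smul_mul_smul_comm, y_mul_t,
      smul_smul, smul_smul, ← z_neg_one, ← aeval_X (R := K) (x := (t : W)),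
      ← smul_mul_assoc, ← smul_mul_assoc, ← map_smul, ← map_smul, ← ofCoeffs_single,
      ← ofCoeffs_single] at h1
    have h2 := congrArg (coeff · 1)
      (Finsupp.single_injective _ (ofCoeffs_injective hq0 hh0 h1))
    simp only [coeff_smul, coeff_X_one, smul_eq_mul, mul_one] at h2
    have h3 : q₀⁻¹ = q₀ := by
      have hne : (α : K) * γ ≠ 0 := mul_ne_zero α.ne_zero γ.ne_zero
      apply mul_left_cancel₀ hne
      linear_combination h2
    rw [pow_two]
    nth_rw 1 [← h3]
    exact inv_mul_cancel₀ hq0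

theorem bijective_of_apply_eq_smul {φ : W →ₐ[K] W} {α β γ : Kˣ}
    (h : h₀.comp (C (γ : K) * X) = C ((α : K) * (β : K)) * h₀) (hx : φ (x 0) = (α : K) • x 0)
    (hy : φ (y 0) = (β : K) • y 0) (ht : φ t = (γ : K) • t) : Function.Bijective φ := by
  have hinv : h₀.comp (C (γ : K)⁻¹ * X) = C ((α : K)⁻¹ * (β : K)⁻¹) * h₀ := by
    have := congrArg (fun p => C ((α : K)⁻¹ * (β : K)⁻¹) * p.comp (C (γ : K)⁻¹ * X)) h
    simp only [comp_C_mul_X_comp_C_mul_X, mul_inv_cancel₀ γ.ne_zero, comp_C_one_mul_X, mul_comp,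
      C_comp] at this
    rw [this, ← mul_assoc, ← C_mul, ← mul_inv,
      inv_mul_cancel₀ (mul_ne_zero α.ne_zero β.ne_zero), C_1, one_mul]
  have hinv' : (h₀.comp (C q₀⁻¹ * X)).comp (C (γ : K)⁻¹ * X) =
      C ((α : K)⁻¹ * (β : K)⁻¹) * h₀.comp (C q₀⁻¹ * X) := by
    rw [comp_C_mul_X_comp_C_mul_X, mul_comm q₀⁻¹, ← comp_C_mul_X_comp_C_mul_X, hinv, mul_comp,
      C_comp]
  obtain ⟨ψ, hψx, hψy, hψt⟩ := exists_algHom (q₀ := q₀) (h₀ := h₀) ((α : K)⁻¹ • x 0 : W)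
    ((β : K)⁻¹ • y 0) ((γ : K)⁻¹ • t)
    (by rw [smul_mul_smul_comm, smul_mul_smul_comm, x_mul_t, smul_comm, mul_comm (α : K)⁻¹])
    (by rw [smul_mul_smul_comm, smul_mul_smul_comm, y_mul_t, smul_comm, mul_comm (β : K)⁻¹])
    (by rw [smul_mul_smul_comm, x_mul_y, aeval_smul_eq_aeval_comp, hinv, ← smul_eq_C_mul, map_smul])
    (by rw [smul_mul_smul_comm, y_mul_x, aeval_smul_eq_aeval_comp, hinv', map_mul, aeval_C,
      ← Algebra.smul_def, mul_comm (β : K)⁻¹])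
  have h₁ : ψ.comp φ = AlgHom.id K W := by
    refine algHom_ext ?_ ?_ ?_ <;> simp [hx, hy, ht, hψx, hψy, hψt, smul_smul]
  have h₂ : φ.comp ψ = AlgHom.id K W := by
    refine algHom_ext ?_ ?_ ?_ <;> simp [hx, hy, ht, hψx, hψy, hψt, smul_smul]
  exact Function.bijective_iff_has_inverse.2
    ⟨ψ, fun w => DFunLike.congr_fun h₁ w, fun w => DFunLike.congr_fun h₂ w⟩

theorem bijective_of_apply_eq_smul_swap {φ : W →ₐ[K] W} {α β γ : Kˣ}
    (h : h₀.comp (C (γ : K) * X) = C ((α : K) * (β : K)) * h₀.comp (-X))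
    (hx : φ (x 0) = (α : K) • y 0) (hy : φ (y 0) = (β : K) • x 0) (ht : φ t = (γ : K) • t) :
    Function.Bijective φ := by
  have hsq : Function.Bijective (φ.comp φ) := by
    refine bijective_of_apply_eq_smul (α := α * β) (β := α * β) (γ := γ * γ) ?_ ?_ ?_ ?_
    · push_cast
      have hneg : (-X : K[X]) = C (-1) * X := by simp
      rw [hneg] at h
      rw [← comp_C_mul_X_comp_C_mul_X, h, mul_comp, C_comp, comp_C_mul_X_comp_C_mul_X,
        mul_comm (-1 : K), ← comp_C_mul_X_comp_C_mul_X, h, mul_comp, C_comp,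
        comp_C_mul_X_comp_C_mul_X, neg_one_mul, neg_neg, comp_C_one_mul_X, ← mul_assoc, ← C_mul]
    · simp [hx, hy, smul_smul]
    · simp [hx, hy, smul_smul, mul_comm]
    · simp [ht, smul_smul]
  rw [AlgHom.coe_comp] at hsq
  exact ⟨hsq.1.of_comp, hsq.2.of_comp⟩

end Automorphisms

end GWA

/-- Proposition 6.1; Suárez-Álvarez–Vivas. Let `W` be a degree one
quantum GWA with `q` a root of unity, `q ≠ 0, 1`, and `h` nonconstant.
(1) If `q² ≠ 1`, a `k`-algebra endomorphism `φ` of `W` is an automorphism iff there are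
`α, β, γ ∈ kˣ` with `h(γt) = αβ·h(t)` such that `φ(x) = αx`, `φ(y) = βy`, `φ(t) = γt`.
(2) If `q = −1`, `φ` is an automorphism iff it has the form in (1) or there are
`α, β, γ ∈ kˣ` with `h(γt) = αβ·h(−t)` such that `φ(x) = αy`, `φ(y) = βx`, `φ(t) = γt`. -/
theorem automorphisms_of_degree_one_quantum_GWA
    (k : Type*) [Field k] (q₀ : k) (h₀ : Polynomial k)
    (hq : IsOfFinOrder q₀) (hq0 : q₀ ≠ 0) (hq1 : q₀ ≠ 1) (hh : 1 ≤ h₀.natDegree)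
    (φ : GWA k 1 (fun _ => q₀) (fun _ => h₀) →ₐ[k] GWA k 1 (fun _ => q₀) (fun _ => h₀)) :
    (q₀ ^ 2 ≠ 1 →
      (Function.Bijective φ ↔
        ∃ α β γ : kˣ,
          h₀.comp (C (γ : k) * X) = C ((α : k) * (β : k)) * h₀ ∧
          φ (GWA.x 0) = (α : k) • GWA.x 0 ∧
          φ (GWA.y 0) = (β : k) • GWA.y 0 ∧
          φ GWA.t = (γ : k) • GWA.t)) ∧
    (q₀ = -1 →
      (Function.Bijective φ ↔
        ((∃ α β γ : kˣ,
          h₀.comp (C (γ : k) * X) = C ((α : k) * (β : k)) * h₀ ∧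
          φ (GWA.x 0) = (α : k) • GWA.x 0 ∧
          φ (GWA.y 0) = (β : k) • GWA.y 0 ∧
          φ GWA.t = (γ : k) • GWA.t) ∨
        (∃ α β γ : kˣ,
          h₀.comp (C (γ : k) * X) = C ((α : k) * (β : k)) * (h₀.comp (-X)) ∧
          φ (GWA.x 0) = (α : k) • GWA.y 0 ∧
          φ (GWA.y 0) = (β : k) • GWA.x 0 ∧
          φ GWA.t = (γ : k) • GWA.t)))) := by
  refine ⟨fun hq2 => ⟨fun hφ => ?_, ?_⟩, fun hq2 => ⟨fun hφ => ?_, ?_⟩⟩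
  · exact (GWA.exists_eq_of_bijective hq0 hq1 hh hφ).resolve_right fun h => hq2 h.1
  · rintro ⟨α, β, γ, h, hx, hy, ht⟩
    exact GWA.bijective_of_apply_eq_smul h hx hy ht
  · refine (GWA.exists_eq_of_bijective hq0 hq1 hh hφ).imp_right fun h => ?_
    subst hq2
    have hneg : (-X : k[X]) = C (-1)⁻¹ * X := by simp [inv_neg]
    rw [hneg]
    exact h.2
  · rintro (⟨α, β, γ, h, hx, hy, ht⟩ | ⟨α, β, γ, h, hx, hy, ht⟩)
    · exact GWA.bijective_of_apply_eq_smul h hx hy ht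
    · exact GWA.bijective_of_apply_eq_smul_swap h hx hy ht
end

section
/- Let W be the degree one quantum GWA with parameters (q, h) in generators x, y, t, and let W' be the degree one quantum GWA with parameters (q', H) in generators X, Y, T, where q, q' ∈ k are roots of unity with q, q' ≠ 1 and h, H ∈ k[t] are nonconstant. Then W and W' are isomorphic as k-algebras if and only if either (i) q' = q and there exist γ, μ ∈ k^× with h(γT) = μ·H(T) in k[T], or (ii) q' = q⁻¹ and there exist γ, μ ∈ k^× with h(γT) = μ·H(q⁻¹T) in k[T]. -/
variable {k : Type*} [Field k] {m : ℕ} {q : Fin m → k} {h : Fin m → Polynomial k}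

open Polynomial

namespace QuantumGWA

section SkewLaurent

variable {k : Type*} [Field k]

/-- The algebra endomorphism `p(t) ↦ p(qⁿt)` of `k[t]`. -/
noncomputable def shift (q : k) (n : ℤ) : k[X] →ₐ[k] k[X] := aeval (C (q ^ n) * X)

theorem shift_eq_comp (q : k) (n : ℤ) (p : k[X]) : shift q n p = p.comp (C (q ^ n) * X) := by
  simp [shift, aeval_def, Polynomial.comp, Polynomial.algebraMap_eq]

theorem shift_X (q : k) (n : ℤ) : shift q n X = C (q ^ n) * X := by simp [shift]

theorem shift_C (q : k) (n : ℤ) (a : k) : shift q n (C a) = C a := by simp [shift_eq_comp]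

theorem shift_zero (q : k) (p : k[X]) : shift q 0 p = p := by simp [shift_eq_comp]

theorem shift_shift {q : k} (hq : q ≠ 0) (n m : ℤ) (p : k[X]) :
    shift q n (shift q m p) = shift q (n + m) p := by
  simp only [shift_eq_comp, comp_assoc]
  rw [mul_comp, C_comp, X_comp, ← mul_assoc, ← C_mul, ← zpow_add₀ hq, add_comm m]

theorem natDegree_shift {q : k} (hq : q ≠ 0) (n : ℤ) (p : k[X]) :
    (shift q n p).natDegree = p.natDegree := by
  rw [shift_eq_comp, natDegree_comp, natDegree_C_mul_X _ (zpow_ne_zero n hq), mul_one]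

theorem shift_ne_zero {q : k} (hq : q ≠ 0) (n : ℤ) {p : k[X]} (hp : p ≠ 0) :
    shift q n p ≠ 0 := by
  intro h
  apply hp
  rw [← shift_zero q p, ← neg_add_cancel n, ← shift_shift hq, h, map_zero]

/-- The operator `p ↦ F · σⁿ(p)` on `k[t]`, where `σ(t) = qt`. -/
noncomputable def op (q : k) (n : ℤ) (F : k[X]) : Module.End k k[X] :=
  LinearMap.mulLeft k F ∘ₗ (shift q n).toLinearMap

theorem op_apply (q : k) (n : ℤ) (F p : k[X]) : op q n F p = F * shift q n p := rfl

theorem op_mul_op {q : k} (hq : q ≠ 0) (n m : ℤ) (F G : k[X]) :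
    op q n F * op q m G = op q (n + m) (F * shift q n G) := by
  refine LinearMap.ext fun p => ?_
  simp [op_apply, shift_shift hq, mul_assoc]

theorem op_inj {q : k} {n : ℤ} {F G : k[X]} : op q n F = op q n G ↔ F = G := by
  refine ⟨fun h => ?_, fun h => h ▸ rfl⟩
  simpa [op_apply] using LinearMap.congr_fun h 1

theorem op_zero (q : k) (n : ℤ) : op q n 0 = 0 := LinearMap.ext fun p => by
  simp [op_apply]

theorem op_eq_zero {q : k} {n : ℤ} {F : k[X]} : op q n F = 0 ↔ F = 0 := by
  rw [← op_zero q n, op_inj]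

theorem op_add (q : k) (n : ℤ) (F G : k[X]) : op q n (F + G) = op q n F + op q n G :=
  LinearMap.ext fun _ => add_mul ..

theorem op_smul (q : k) (n : ℤ) (a : k) (F : k[X]) : op q n (a • F) = a • op q n F :=
  LinearMap.ext fun p => smul_mul_assoc a F (shift q n p)

/-- Laurent polynomials with operator coefficients; this algebra contains the skew Laurent
polynomial ring over `k[t]`. -/
abbrev Lau (k : Type*) [Field k] : Type _ := AddMonoidAlgebra (Module.End k k[X]) ℤ

/-- The element `F(t) xⁿ` of the skew Laurent polynomial ring. -/
noncomputable def mon (q : k) (n : ℤ) (F : k[X]) : Lau k := AddMonoidAlgebra.single n (op q n F)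

theorem mon_mul_mon {q : k} (hq : q ≠ 0) (n m : ℤ) (F G : k[X]) :
    mon q n F * mon q m G = mon q (n + m) (F * shift q n G) := by
  rw [mon, mon, mon, AddMonoidAlgebra.single_mul_single, op_mul_op hq]

theorem mon_add (q : k) (n : ℤ) (F G : k[X]) : mon q n (F + G) = mon q n F + mon q n G := by
  rw [mon, mon, mon, op_add, AddMonoidAlgebra.single_add]

theorem mon_smul (q : k) (n : ℤ) (a : k) (F : k[X]) : mon q n (a • F) = a • mon q n F := by
  rw [mon, mon, op_smul, AddMonoidAlgebra.smul_single]

theorem mon_zero (q : k) (n : ℤ) : mon q n 0 = 0 := by simp [mon, op_zero]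

theorem mon_zero_one (q : k) : mon q 0 1 = 1 := by
  rw [AddMonoidAlgebra.one_def, mon]
  congr 1
  refine LinearMap.ext fun p => ?_
  simp [op_apply, shift_zero]

theorem mon_inj {q : k} {n : ℤ} {F G : k[X]} : mon q n F = mon q n G ↔ F = G := by
  rw [mon, mon, AddMonoidAlgebra.single_right_inj, op_inj]

theorem mon_eq_mon {q : k} {n m : ℤ} {F G : k[X]} (hF : F ≠ 0) (h : mon q n F = mon q m G) :
    n = m ∧ F = G := by
  rcases AddMonoidAlgebra.single_inj.1 h with ⟨rfl, h⟩ | ⟨h, _⟩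
  · exact ⟨rfl, op_inj.1 h⟩
  · exact absurd (op_eq_zero.1 h) hF

theorem coeff_mon (q : k) (n m : ℤ) (F : k[X]) :
    (mon q n F).coeff m = if n = m then op q m F else 0 := by
  classical
  rw [mon, AddMonoidAlgebra.coeff_single, Finsupp.single_apply]
  split_ifs with h
  · rw [h]
  · rfl

theorem mon_zero_pow {q : k} (hq : q ≠ 0) (F : k[X]) (i : ℕ) : mon q 0 F ^ i = mon q 0 (F ^ i) := by
  induction i with
  | zero => simp [mon_zero_one]
  | succ i ih => rw [pow_succ, ih, mon_mul_mon hq, shift_zero, pow_succ, add_zero]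

theorem aeval_mon_zero {q : k} (hq : q ≠ 0) (F p : k[X]) :
    aeval (mon q 0 F) p = mon q 0 (p.comp F) := by
  induction p using Polynomial.induction_on' with
  | add p r hp hr => rw [map_add, hp, hr, add_comp, mon_add]
  | monomial i a =>
    rw [aeval_monomial, monomial_comp, mon_zero_pow hq, ← smul_eq_C_mul, mon_smul,
      Algebra.algebraMap_eq_smul_one, smul_mul_assoc, one_mul]

/-- If a product of two skew Laurent polynomials is a nonzero monomial, so is each factor. -/
theorem monomial_factors {q : k} (hq : q ≠ 0) {a b : Lau k} {A B : ℤ → k[X]}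
    (hA : ∀ n, a.coeff n = op q n (A n)) (hB : ∀ n, b.coeff n = op q n (B n))
    {d : ℤ} {F : k[X]} (hF : F ≠ 0) (hab : a * b = mon q d F) :
    ∃ n, a = mon q n (A n) ∧ b = mon q (d - n) (B (d - n)) := by
  have hab0 : a * b ≠ 0 := by
    rw [hab, ← mon_zero q d]
    exact fun h => hF (mon_inj.1 h)
  have ha : a.coeff.support.Nonempty := by
    rw [Finsupp.support_nonempty_iff, Ne, AddMonoidAlgebra.coeff_eq_zero]
    exact left_ne_zero_of_mul hab0
  have hb : b.coeff.support.Nonempty := by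
    rw [Finsupp.support_nonempty_iff, Ne, AddMonoidAlgebra.coeff_eq_zero]
    exact right_ne_zero_of_mul hab0
  have key : ∀ n ∈ a.coeff.support, ∀ m ∈ b.coeff.support,
      UniqueAdd a.coeff.support b.coeff.support n m → n + m = d := by
    intro n hn m hm hu
    have h := AddMonoidAlgebra.coeff_mul_add_of_uniqueAdd hu
    rw [Finsupp.mem_support_iff, hA, Ne, op_eq_zero] at hn
    rw [Finsupp.mem_support_iff, hB, Ne, op_eq_zero] at hm
    by_contra hne
    rw [hab, coeff_mon, if_neg (Ne.symm hne), hA, hB, op_mul_op hq, eq_comm, op_eq_zero] at h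
    exact mul_ne_zero hn (shift_ne_zero hq _ hm) h
  have hmax := key _ (a.coeff.support.max'_mem ha) _ (b.coeff.support.max'_mem hb) (by
    intro n m hn hm h
    have h1 := Finset.le_max' _ _ hn
    have h2 := Finset.le_max' _ _ hm
    omega)
  have hmin := key _ (a.coeff.support.min'_mem ha) _ (b.coeff.support.min'_mem hb) (by
    intro n m hn hm h
    have h1 := Finset.min'_le _ _ hn
    have h2 := Finset.min'_le _ _ hm
    omega)
  have ha' := Finset.min'_le _ _ (a.coeff.support.max'_mem ha)
  have hb' := Finset.min'_le _ _ (b.coeff.support.max'_mem hb)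
  refine ⟨a.coeff.support.max' ha, ?_, ?_⟩
  · apply AddMonoidAlgebra.coeff_injective
    ext1 m
    rw [coeff_mon]
    split_ifs with h
    · rw [hA, ← h]
    · by_contra hm
      have hm := Finsupp.mem_support_iff.2 hm
      have h1 := Finset.le_max' _ _ hm
      have h2 := Finset.min'_le _ _ hm
      omega
  · apply AddMonoidAlgebra.coeff_injective
    ext1 m
    rw [coeff_mon]
    split_ifs with h
    · rw [hB, ← h]
    · by_contra hm
      have hm := Finsupp.mem_support_iff.2 hm
      have h1 := Finset.le_max' _ _ hm
      have h2 := Finset.min'_le _ _ hm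
      omega

end SkewLaurent

section Representation

variable {k : Type*} [Field k]

/-- The degree one quantum generalized Weyl algebra with parameters `(q, h)`. -/
abbrev W (q : k) (h : k[X]) : Type _ := GWA k 1 (fun _ => q) (fun _ => h)

theorem x_mul_t (q : k) (h : k[X]) :
    (GWA.x 0 * GWA.t : W q h) = q • (GWA.t * GWA.x 0) := by
  simpa [GWA.x, GWA.t] using
    RingQuot.mkAlgHom_rel k (GWARel.xt (q := fun _ : Fin 1 => q) (h := fun _ => h) 0)

theorem y_mul_t (q : k) (h : k[X]) :
    (GWA.y 0 * GWA.t : W q h) = q⁻¹ • (GWA.t * GWA.y 0) := by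
  simpa [GWA.y, GWA.t] using
    RingQuot.mkAlgHom_rel k (GWARel.yt (q := fun _ : Fin 1 => q) (h := fun _ => h) 0)

theorem x_mul_y (q : k) (h : k[X]) :
    (GWA.x 0 * GWA.y 0 : W q h) = aeval (GWA.t : W q h) h := by
  have := RingQuot.mkAlgHom_rel k (GWARel.xy (q := fun _ : Fin 1 => q) (h := fun _ => h) 0)
  rwa [map_mul, ← aeval_algHom_apply] at this

theorem y_mul_x (q : k) (h : k[X]) :
    (GWA.y 0 * GWA.x 0 : W q h) = aeval (q⁻¹ • GWA.t : W q h) h := by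
  have := RingQuot.mkAlgHom_rel k (GWARel.yx (q := fun _ : Fin 1 => q) (h := fun _ => h) 0)
  rwa [map_mul, ← aeval_algHom_apply, map_smul] at this

/-- Algebra homomorphisms out of `W q h` from images of the generators. -/
theorem exists_lift {B : Type*} [Semiring B] [Algebra k B] {q : k} {h : k[X]} (x y t : B)
    (hxt : x * t = q • (t * x)) (hyt : y * t = q⁻¹ • (t * y)) (hxy : x * y = aeval t h)
    (hyx : y * x = aeval (q⁻¹ • t) h) :
    ∃ f : W q h →ₐ[k] B, f (GWA.x 0) = x ∧ f (GWA.y 0) = y ∧ f GWA.t = t := by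
  let g : GWAGen 1 → B := fun s => match s with
    | .x _ => x
    | .y _ => y
    | .t => t
  have hg : ∀ ⦃a b⦄, GWARel k 1 (fun _ => q) (fun _ => h) a b →
      FreeAlgebra.lift k g a = FreeAlgebra.lift k g b := by
    intro a b hab
    cases hab with
    | xt i => simpa [g] using hxt
    | yt i => simpa [g] using hyt
    | xy i => simpa [g, ← aeval_algHom_apply] using hxy
    | yx i => simpa [g, ← aeval_algHom_apply] using hyx
    | xx i j hij => exact absurd (Subsingleton.elim i j) hij
    | yy i j hij => exact absurd (Subsingleton.elim i j) hij
    | xyc i j hij => exact absurd (Subsingleton.elim i j) hij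
  refine ⟨RingQuot.liftAlgHom k ⟨FreeAlgebra.lift k g, hg⟩, ?_, ?_, ?_⟩
  · simp [GWA.x, g]
  · simp [GWA.y, g]
  · simp [GWA.t, g]

theorem hom_ext {B : Type*} [Semiring B] [Algebra k B] {q : k} {h : k[X]} {f g : W q h →ₐ[k] B}
    (hx : f (GWA.x 0) = g (GWA.x 0)) (hy : f (GWA.y 0) = g (GWA.y 0))
    (ht : f GWA.t = g GWA.t) : f = g := by
  apply RingQuot.ringQuot_ext'
  apply FreeAlgebra.hom_ext
  funext s
  rcases s with i | i | _
  · rw [Subsingleton.elim i 0]; exact hx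
  · rw [Subsingleton.elim i 0]; exact hy
  · exact ht

theorem induction_left {q : k} {h : k[X]} (M : Submodule k (W q h))
    (h1 : (1 : W q h) ∈ M) (hx : ∀ m ∈ M, GWA.x 0 * m ∈ M) (hy : ∀ m ∈ M, GWA.y 0 * m ∈ M)
    (ht : ∀ m ∈ M, GWA.t * m ∈ M) (w : W q h) : w ∈ M := by
  suffices H : ∀ m ∈ M, w * m ∈ M by simpa using H 1 h1
  obtain ⟨a, rfl⟩ := RingQuot.mkAlgHom_surjective k _ w
  induction a using FreeAlgebra.induction with
  | grade0 r =>
    intro m hm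
    rw [AlgHom.commutes, ← Algebra.smul_def]
    exact M.smul_mem r hm
  | grade1 s =>
    rcases s with i | i | _
    · rw [Subsingleton.elim i 0]; exact hx
    · rw [Subsingleton.elim i 0]; exact hy
    · exact ht
  | mul a b ha hb =>
    intro m hm
    rw [map_mul, mul_assoc]
    exact ha _ (hb m hm)
  | add a b ha hb =>
    intro m hm
    rw [map_add, add_mul]
    exact M.add_mem (ha m hm) (hb m hm)

/-- The faithful graded representation of `W q h` has `x ↦ x`, `t ↦ t` and
`y ↦ h(q⁻¹t) x⁻¹`. -/
theorem exists_rep {q : k} (hq : q ≠ 0) (h : k[X]) :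
    ∃ f : W q h →ₐ[k] Lau k, f (GWA.x 0) = mon q 1 1 ∧
      f (GWA.y 0) = mon q (-1) (shift q (-1) h) ∧ f GWA.t = mon q 0 X := by
  apply exists_lift
  · rw [mon_mul_mon hq, mon_mul_mon hq, ← mon_smul, shift_X]
    simp [smul_eq_C_mul]
  · rw [mon_mul_mon hq, mon_mul_mon hq, ← mon_smul, shift_X, shift_zero]
    simp [smul_eq_C_mul]
    ring_nf
  · rw [mon_mul_mon hq, aeval_mon_zero hq, shift_shift hq]
    simp [shift_zero]
  · rw [mon_mul_mon hq, ← mon_smul, aeval_mon_zero hq, shift_eq_comp]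
    simp [smul_eq_C_mul]

/-- The graded representation of `W q h` in the skew Laurent polynomial ring. -/
noncomputable def rep {q : k} (hq : q ≠ 0) (h : k[X]) : W q h →ₐ[k] Lau k :=
  (exists_rep hq h).choose

theorem rep_x {q : k} (hq : q ≠ 0) (h : k[X]) : rep hq h (GWA.x 0) = mon q 1 1 :=
  (exists_rep hq h).choose_spec.1

theorem rep_y {q : k} (hq : q ≠ 0) (h : k[X]) :
    rep hq h (GWA.y 0) = mon q (-1) (shift q (-1) h) :=
  (exists_rep hq h).choose_spec.2.1

theorem rep_t {q : k} (hq : q ≠ 0) (h : k[X]) : rep hq h GWA.t = mon q 0 X :=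
  (exists_rep hq h).choose_spec.2.2

theorem rep_aeval_t {q : k} (hq : q ≠ 0) (h p : k[X]) :
    rep hq h (aeval (GWA.t : W q h) p) = mon q 0 p := by
  rw [← aeval_algHom_apply, rep_t, aeval_mon_zero hq, comp_X]

/-- The coefficient of `yᴺ` in the skew Laurent polynomial ring. -/
noncomputable def yCoeff (q : k) (h : k[X]) (N : ℕ) : k[X] :=
  ∏ i ∈ Finset.range N, shift q (-(i + 1 : ℕ)) h

theorem natDegree_yCoeff {q : k} (hq : q ≠ 0) {h : k[X]} (hh : h ≠ 0) (N : ℕ) :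
    (yCoeff q h N).natDegree = N * h.natDegree := by
  rw [yCoeff, natDegree_prod _ _ fun i _ => shift_ne_zero hq _ hh]
  simp [natDegree_shift hq]

theorem yCoeff_ne_zero {q : k} (hq : q ≠ 0) {h : k[X]} (hh : h ≠ 0) (N : ℕ) :
    yCoeff q h N ≠ 0 :=
  Finset.prod_ne_zero_iff.2 fun _ _ => shift_ne_zero hq _ hh

theorem rep_x_pow {q : k} (hq : q ≠ 0) (h : k[X]) (N : ℕ) :
    rep hq h (GWA.x 0 ^ N) = mon q N 1 := by
  induction N with
  | zero => simp [mon_zero_one]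
  | succ N ih => rw [pow_succ, map_mul, ih, rep_x, mon_mul_mon hq]; simp

theorem rep_y_pow {q : k} (hq : q ≠ 0) (h : k[X]) (N : ℕ) :
    rep hq h (GWA.y 0 ^ N) = mon q (-N) (yCoeff q h N) := by
  induction N with
  | zero => simp [mon_zero_one, yCoeff]
  | succ N ih =>
    rw [pow_succ, map_mul, ih, rep_y, mon_mul_mon hq, shift_shift hq, yCoeff, yCoeff,
      Finset.prod_range_succ]
    push_cast
    ring_nf

/-- The homogeneous element `xⁿ` or `y⁻ⁿ` of degree `n`. -/
noncomputable def base (q : k) (h : k[X]) (n : ℤ) : W q h :=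
  if 0 ≤ n then GWA.x 0 ^ n.toNat else GWA.y 0 ^ (-n).toNat

/-- The leading coefficient of `base q h n` in the skew Laurent polynomial ring. -/
noncomputable def baseCoeff (q : k) (h : k[X]) (n : ℤ) : k[X] := yCoeff q h (-n).toNat

theorem rep_base {q : k} (hq : q ≠ 0) (h : k[X]) (n : ℤ) :
    rep hq h (base q h n) = mon q n (baseCoeff q h n) := by
  rw [base, baseCoeff]
  split_ifs with hn
  · rw [rep_x_pow, Int.toNat_of_nonneg hn, Int.toNat_of_nonpos (by omega)]
    simp [yCoeff]
  · rw [rep_y_pow, Int.toNat_of_nonneg (by omega), neg_neg]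

theorem x_mul_aeval (q : k) (h p : k[X]) :
    (GWA.x 0 * aeval (GWA.t : W q h) p : W q h) = aeval (GWA.t : W q h) (shift q 1 p) * GWA.x 0 := by
  induction p using Polynomial.induction_on' with
  | add p r hp hr => simp only [map_add, mul_add, add_mul, hp, hr]
  | monomial i a =>
    rw [← C_mul_X_pow_eq_monomial, map_mul, map_mul, map_mul, shift_C, map_pow, map_pow, map_pow,
      shift_X, aeval_C, ← mul_assoc, ← Algebra.commutes, mul_assoc, mul_assoc]
    congr 1
    induction i with
    | zero => simp
    | succ i ih =>
      rw [pow_succ, pow_succ, ← mul_assoc, ih, mul_assoc, mul_assoc]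
      congr 1
      simp [x_mul_t, Algebra.smul_def, mul_assoc]

theorem y_mul_aeval (q : k) (h p : k[X]) :
    (GWA.y 0 * aeval (GWA.t : W q h) p : W q h) =
      aeval (GWA.t : W q h) (shift q (-1) p) * GWA.y 0 := by
  induction p using Polynomial.induction_on' with
  | add p r hp hr => simp only [map_add, mul_add, add_mul, hp, hr]
  | monomial i a =>
    rw [← C_mul_X_pow_eq_monomial, map_mul, map_mul, map_mul, shift_C, map_pow, map_pow, map_pow,
      shift_X, aeval_C, ← mul_assoc, ← Algebra.commutes, mul_assoc, mul_assoc]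
    congr 1
    induction i with
    | zero => simp
    | succ i ih =>
      rw [pow_succ, pow_succ, ← mul_assoc, ih, mul_assoc, mul_assoc]
      congr 1
      simp [y_mul_t, Algebra.smul_def, mul_assoc]

theorem aeval_smul_t (q : k) (h p : k[X]) :
    aeval (q⁻¹ • GWA.t : W q h) p = aeval (GWA.t : W q h) (shift q (-1) p) := by
  rw [shift_eq_comp, aeval_comp]
  simp [Algebra.smul_def]

theorem x_mul_base (q : k) (h : k[X]) (n : ℤ) :
    ∃ c : k[X], (GWA.x 0 * base q h n : W q h) = aeval (GWA.t : W q h) c * base q h (n + 1) := by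
  by_cases hn : 0 ≤ n
  · refine ⟨1, ?_⟩
    rw [base, base, if_pos hn, if_pos (by omega), Int.toNat_add hn zero_le_one]
    simp [pow_succ']
  · refine ⟨h, ?_⟩
    obtain ⟨N, rfl⟩ : ∃ N : ℕ, n = -(N + 1) := ⟨(-n - 1).toNat, by omega⟩
    rw [base, if_neg hn, show (-(-((N : ℤ) + 1))).toNat = N + 1 by omega, pow_succ', ← mul_assoc,
      x_mul_y]
    congr 1
    rcases N with _ | N
    · simp [base]
    · rw [base, if_neg (by omega)]
      congr 1

theorem y_mul_base (q : k) (h : k[X]) (n : ℤ) :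
    ∃ c : k[X], (GWA.y 0 * base q h n : W q h) = aeval (GWA.t : W q h) c * base q h (n - 1) := by
  by_cases hn : n ≤ 0
  · refine ⟨1, ?_⟩
    obtain ⟨N, rfl⟩ : ∃ N : ℕ, n = -N := ⟨(-n).toNat, by omega⟩
    rw [base, base, if_neg (show ¬ 0 ≤ -(N : ℤ) - 1 by omega),
      show (-(-(N : ℤ) - 1)).toNat = N + 1 by omega]
    rcases N with _ | N
    · simp
    · rw [if_neg (by omega), show (-(-((N + 1 : ℕ) : ℤ))).toNat = N + 1 by omega]
      simp [pow_succ']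
  · refine ⟨shift q (-1) h, ?_⟩
    obtain ⟨N, rfl⟩ : ∃ N : ℕ, n = N + 1 := ⟨(n - 1).toNat, by omega⟩
    rw [base, base, if_pos (by omega), if_pos (by omega), show ((N : ℤ) + 1).toNat = N + 1 by omega,
      show ((N : ℤ) + 1 - 1).toNat = N by omega, pow_succ', ← mul_assoc, y_mul_x, aeval_smul_t]

/-- The element `∑ fₙ(t) · base n`. -/
noncomputable def ofCoeffs (q : k) (h : k[X]) : (ℤ →₀ k[X]) →ₗ[k] W q h :=
  Finsupp.lsum k fun n =>
    (LinearMap.mulRight k (base q h n)) ∘ₗ (aeval (GWA.t : W q h)).toLinearMap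

theorem ofCoeffs_single (q : k) (h : k[X]) (n : ℤ) (p : k[X]) :
    ofCoeffs q h (Finsupp.single n p) = aeval (GWA.t : W q h) p * base q h n := by
  simp [ofCoeffs]

theorem ofCoeffs_surjective (q : k) (h : k[X]) : Function.Surjective (ofCoeffs q h) := by
  have key : ∀ (z : W q h), (∀ (n : ℤ) (p : k[X]), z * (aeval (GWA.t : W q h) p * base q h n) ∈
      LinearMap.range (ofCoeffs q h)) →
      ∀ m ∈ LinearMap.range (ofCoeffs q h), z * m ∈ LinearMap.range (ofCoeffs q h) := by
    rintro z hz _ ⟨f, rfl⟩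
    induction f using Finsupp.induction_linear with
    | zero => simp
    | add f g hf hg => rw [map_add, mul_add]; exact Submodule.add_mem _ hf hg
    | single n p => rw [ofCoeffs_single]; exact hz n p
  intro w
  refine induction_left (LinearMap.range (ofCoeffs q h)) ⟨Finsupp.single 0 1, ?_⟩
    (key _ fun n p => ?_) (key _ fun n p => ?_) (key _ fun n p => ?_) w
  · simp [ofCoeffs_single, base]
  · obtain ⟨c, hc⟩ := x_mul_base q h n
    refine ⟨Finsupp.single (n + 1) (shift q 1 p * c), ?_⟩
    rw [ofCoeffs_single, ← mul_assoc, x_mul_aeval, mul_assoc, hc, map_mul, mul_assoc]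
  · obtain ⟨c, hc⟩ := y_mul_base q h n
    refine ⟨Finsupp.single (n - 1) (shift q (-1) p * c), ?_⟩
    rw [ofCoeffs_single, ← mul_assoc, y_mul_aeval, mul_assoc, hc, map_mul, mul_assoc]
  · refine ⟨Finsupp.single n (X * p), ?_⟩
    rw [ofCoeffs_single, map_mul, aeval_X, mul_assoc]

theorem rep_ofCoeffs_coeff {q : k} (hq : q ≠ 0) (h : k[X]) (f : ℤ →₀ k[X]) (n : ℤ) :
    (rep hq h (ofCoeffs q h f)).coeff n = op q n (f n * baseCoeff q h n) := by
  classical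
  induction f using Finsupp.induction_linear with
  | zero => simp [op_zero]
  | add f g hf hg =>
    rw [map_add, map_add, AddMonoidAlgebra.coeff_add, Finsupp.add_apply, hf, hg, Finsupp.add_apply,
      add_mul, op_add]
  | single m p =>
    rw [ofCoeffs_single, map_mul, rep_aeval_t, rep_base, mon_mul_mon hq, shift_zero, zero_add,
      coeff_mon, Finsupp.single_apply]
    split_ifs with hmn
    · rw [hmn]
    · rw [zero_mul, op_zero]

theorem rep_injective {q : k} (hq : q ≠ 0) {h : k[X]} (hh : h ≠ 0) :
    Function.Injective (rep hq h) := by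
  rw [injective_iff_map_eq_zero]
  intro w hw
  obtain ⟨f, rfl⟩ := ofCoeffs_surjective q h w
  suffices f = 0 by rw [this, map_zero]
  ext1 n
  have := rep_ofCoeffs_coeff hq h f n
  rw [hw, AddMonoidAlgebra.coeff_zero, Finsupp.zero_apply, eq_comm, op_eq_zero] at this
  exact (mul_eq_zero.1 this).resolve_right (yCoeff_ne_zero hq hh _)

end Representation

section Divisors

variable {k : Type*} [Field k]

theorem baseCoeff_ne_zero {q : k} (hq : q ≠ 0) {h : k[X]} (hh : h ≠ 0) (n : ℤ) :
    baseCoeff q h n ≠ 0 :=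
  yCoeff_ne_zero hq hh _

theorem natDegree_baseCoeff {q : k} (hq : q ≠ 0) {h : k[X]} (hh : h ≠ 0) (n : ℤ) :
    (baseCoeff q h n).natDegree = (-n).toNat * h.natDegree :=
  natDegree_yCoeff hq hh _

theorem rep_aeval_mul_base {q : k} (hq : q ≠ 0) (h p : k[X]) (n : ℤ) :
    rep hq h (aeval (GWA.t : W q h) p * base q h n) = mon q n (p * baseCoeff q h n) := by
  rw [map_mul, rep_aeval_t, rep_base, mon_mul_mon hq, shift_zero, zero_add]

theorem exists_factors {q : k} (hq : q ≠ 0) {h : k[X]} (hh : h ≠ 0) {a b : W q h} {d : ℤ} {F : k[X]}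
    (hF : F ≠ 0) (hab : rep hq h (a * b) = mon q d F) :
    ∃ (n : ℤ) (f g : k[X]), a = aeval (GWA.t : W q h) f * base q h n ∧
      b = aeval (GWA.t : W q h) g * base q h (d - n) ∧ f ≠ 0 ∧ g ≠ 0 ∧
      f * baseCoeff q h n * shift q n (g * baseCoeff q h (d - n)) = F := by
  obtain ⟨f, hf⟩ := ofCoeffs_surjective q h a
  obtain ⟨g, hg⟩ := ofCoeffs_surjective q h b
  rw [map_mul] at hab
  obtain ⟨n, han, hbn⟩ := monomial_factors hq
    (fun m => hf ▸ rep_ofCoeffs_coeff hq h f m) (fun m => hg ▸ rep_ofCoeffs_coeff hq h g m) hF hab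
  have hprod : f n * baseCoeff q h n * shift q n (g (d - n) * baseCoeff q h (d - n)) = F := by
    rw [han, hbn, mon_mul_mon hq, add_sub_cancel] at hab
    exact mon_inj.1 hab
  refine ⟨n, f n, g (d - n), rep_injective hq hh ?_, rep_injective hq hh ?_, ?_, ?_, hprod⟩
  · rw [han, rep_aeval_mul_base]
  · rw [hbn, rep_aeval_mul_base]
  · rintro h0
    rw [h0] at hprod
    simp at hprod
    exact hF hprod.symm
  · rintro h0
    rw [h0] at hprod
    simp at hprod
    exact hF hprod.symm

theorem aeval_mul_base_inj {q : k} (hq : q ≠ 0) {h : k[X]} (hh : h ≠ 0) {f g : k[X]} {n m : ℤ}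
    (hf : f ≠ 0) (he : (aeval (GWA.t : W q h) f * base q h n : W q h) =
      aeval (GWA.t : W q h) g * base q h m) : n = m ∧ f = g := by
  have := congrArg (rep hq h) he
  rw [rep_aeval_mul_base, rep_aeval_mul_base] at this
  obtain ⟨rfl, h2⟩ := mon_eq_mon (mul_ne_zero hf (baseCoeff_ne_zero hq hh _)) this
  exact ⟨rfl, mul_right_cancel₀ (baseCoeff_ne_zero hq hh _) h2⟩

theorem natDegree_factors {q : k} (hq : q ≠ 0) {h : k[X]} (hh : h ≠ 0) {f g : k[X]}
    (hf : f ≠ 0) (hg : g ≠ 0) (n m : ℤ) :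
    (f * baseCoeff q h n * shift q n (g * baseCoeff q h m)).natDegree =
      f.natDegree + (-n).toNat * h.natDegree + (g.natDegree + (-m).toNat * h.natDegree) := by
  have h1 := baseCoeff_ne_zero hq hh n
  have h2 := baseCoeff_ne_zero hq hh m
  rw [natDegree_mul (mul_ne_zero hf h1) (shift_ne_zero hq _ (mul_ne_zero hg h2)),
    natDegree_shift hq, natDegree_mul hf h1, natDegree_mul hg h2, natDegree_baseCoeff hq hh,
    natDegree_baseCoeff hq hh]

theorem exists_C_of_natDegree_eq_zero {f : k[X]} (hf : f ≠ 0) (hd : f.natDegree = 0) :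
    ∃ c : k, c ≠ 0 ∧ f = C c := by
  obtain ⟨c, rfl⟩ := natDegree_eq_zero.1 hd
  exact ⟨c, fun h => hf (by rw [h, C_0]), rfl⟩

theorem base_zero (q : k) (h : k[X]) : base q h 0 = 1 := by simp [base]

theorem base_one (q : k) (h : k[X]) : base q h 1 = GWA.x 0 := by simp [base]

theorem base_neg_one (q : k) (h : k[X]) : base q h (-1) = GWA.y 0 := by simp [base]

theorem baseCoeff_of_nonneg (q : k) (h : k[X]) {n : ℤ} (hn : 0 ≤ n) : baseCoeff q h n = 1 := by
  rw [baseCoeff, Int.toNat_of_nonpos (by omega), yCoeff, Finset.prod_range_zero]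

theorem baseCoeff_neg_one (q : k) (h : k[X]) : baseCoeff q h (-1) = shift q (-1) h := by
  simp [baseCoeff, yCoeff]

theorem baseCoeff_neg_two (q : k) (h : k[X]) :
    baseCoeff q h (-2) = shift q (-1) h * shift q (-2) h := by
  simp [baseCoeff, yCoeff, Finset.prod_range_succ]

/-- A common left divisor of `tx` and `ty` is a unit, a multiple of `t`, or else (when `h` is a
multiple of `t`) a multiple of `x` or `y` which divides `t`. -/
theorem left_divisor_cases {q : k} (hq : q ≠ 0) {h : k[X]} (hh : 1 ≤ h.natDegree) {w a b : W q h}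
    (ha : w * a = GWA.t * GWA.x 0) (hb : w * b = GWA.t * GWA.y 0) :
    (∃ c : k, w = algebraMap k _ c) ∨ (∃ c : k, c ≠ 0 ∧ w = c • GWA.t) ∨
      ((∃ z, GWA.t = w * z) ∧
        ∃ (c : k) (n : ℤ), c ≠ 0 ∧ w = aeval (GWA.t : W q h) (C c) * base q h n) := by
  have hh0 : h ≠ 0 := by rintro rfl; simp at hh
  have ht : (GWA.t : W q h) = aeval (GWA.t : W q h) (X : k[X]) := (aeval_X _).symm
  have hX : (X : k[X]) ≠ 0 := X_ne_zero
  have hXh := mul_ne_zero hX (shift_ne_zero hq (-1) hh0)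
  obtain ⟨n, f, g, hw, -, hf, hg, hfg⟩ := exists_factors hq hh0 (d := 1) hX
    (show rep hq h (w * a) = mon q 1 X by
      rw [ha, map_mul, rep_t, rep_x, mon_mul_mon hq]; simp)
  obtain ⟨n', f', e, hw', -, -, he, hfe⟩ := exists_factors hq hh0 (d := -1) hXh
    (show rep hq h (w * b) = mon q (-1) (X * shift q (-1) h) by
      rw [hb, map_mul, rep_t, rep_y, mon_mul_mon hq, shift_zero]; simp)
  obtain ⟨rfl, rfl⟩ := aeval_mul_base_inj hq hh0 hf (hw.symm.trans hw')
  have d1 := congrArg natDegree hfg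
  have d2 := congrArg natDegree hfe
  rw [natDegree_factors hq hh0 hf hg, natDegree_X] at d1
  rw [natDegree_factors hq hh0 hf he, natDegree_mul hX (shift_ne_zero hq _ hh0), natDegree_X,
    natDegree_shift hq] at d2
  rcases lt_trichotomy n 0 with hn | rfl | hn
  · right; right
    obtain ⟨N, rfl⟩ : ∃ N : ℕ, n = -(N + 1) := ⟨(-n - 1).toNat, by omega⟩
    rw [show (-(-((N : ℤ) + 1))).toNat = N + 1 by omega, add_mul, one_mul] at d1
    obtain rfl : N = 0 := by
      by_contra hN
      have := Nat.mul_le_mul (Nat.one_le_iff_ne_zero.2 hN) hh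
      omega
    obtain ⟨c, hc, rfl⟩ := exists_C_of_natDegree_eq_zero hf (by omega)
    obtain ⟨c', -, rfl⟩ := exists_C_of_natDegree_eq_zero hg (by omega)
    refine ⟨⟨c' • GWA.x 0, ?_⟩, c, _, hc, hw⟩
    simp only [Nat.cast_zero, zero_add, baseCoeff_neg_one, sub_neg_eq_add] at hfg hw
    rw [baseCoeff_of_nonneg _ _ (by norm_num), mul_one, shift_C] at hfg
    rw [ht, ← hfg, hw, base_neg_one, mul_smul_comm, mul_assoc (aeval _ _), y_mul_x, aeval_smul_t,
      mul_comm _ (C c'), map_mul, map_mul, aeval_C, ← Algebra.smul_def]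
  · rw [base_zero, mul_one] at hw
    rw [baseCoeff_of_nonneg _ _ le_rfl, baseCoeff_of_nonneg _ _ (by norm_num), shift_zero, mul_one,
      mul_one] at hfg
    by_cases hd : f.natDegree = 0
    · obtain ⟨c, -, rfl⟩ := exists_C_of_natDegree_eq_zero hf hd
      exact Or.inl ⟨c, by rw [hw, aeval_C]⟩
    · obtain ⟨c', hc', rfl⟩ := exists_C_of_natDegree_eq_zero hg (by omega)
      refine Or.inr (Or.inl ⟨c'⁻¹, inv_ne_zero hc', ?_⟩)
      rw [ht, ← hfg, mul_comm, map_mul, aeval_C, ← Algebra.smul_def, smul_smul,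
        inv_mul_cancel₀ hc', one_smul, hw]
  · right; right
    obtain ⟨N, rfl⟩ : ∃ N : ℕ, n = N + 1 := ⟨(n - 1).toNat, by omega⟩
    rw [show (-(-1 - ((N : ℤ) + 1))).toNat = N + 1 + 1 by omega, add_mul, add_mul, one_mul] at d2
    obtain rfl : N = 0 := by
      by_contra hN
      have := Nat.mul_le_mul (Nat.one_le_iff_ne_zero.2 hN) hh
      omega
    obtain ⟨c, hc, rfl⟩ := exists_C_of_natDegree_eq_zero hf (by omega)
    obtain ⟨c', -, rfl⟩ := exists_C_of_natDegree_eq_zero he (by omega)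
    refine ⟨⟨c' • GWA.y 0, ?_⟩, c, _, hc, hw⟩
    simp only [Nat.cast_zero, zero_add] at hfe hw
    rw [baseCoeff_of_nonneg _ _ (by norm_num), mul_one, show (-1 - 1 : ℤ) = -2 by norm_num,
      baseCoeff_neg_two, map_mul, map_mul, shift_C, shift_shift hq, shift_shift hq,
      show (1 + -1 : ℤ) = 0 by norm_num, show (1 + -2 : ℤ) = -1 by norm_num, shift_zero,
      ← mul_assoc, ← mul_assoc] at hfe
    have hfe := mul_right_cancel₀ (shift_ne_zero hq (-1) hh0) hfe
    rw [ht, ← hfe, hw, base_one, mul_smul_comm, mul_assoc (aeval _ _), x_mul_y,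
      mul_comm (C c), mul_assoc, map_mul, map_mul, aeval_C, ← Algebra.smul_def]

end Divisors

section Commutators

variable {k : Type*} [Field k]

/-- The right ideal `tW`. -/
noncomputable def tIdeal (q : k) (h : k[X]) : Submodule k (W q h) :=
  LinearMap.range (LinearMap.mulLeft k (GWA.t : W q h))

theorem mem_tIdeal {q : k} {h : k[X]} {w : W q h} : w ∈ tIdeal q h ↔ ∃ z, GWA.t * z = w := Iff.rfl

theorem tIdeal_mul_right {q : k} {h : k[X]} {w : W q h} (hw : w ∈ tIdeal q h) (z : W q h) :
    w * z ∈ tIdeal q h := by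
  obtain ⟨u, rfl⟩ := mem_tIdeal.1 hw
  exact mem_tIdeal.2 ⟨u * z, (mul_assoc _ _ _).symm⟩

theorem x_mul_mem_tIdeal {q : k} {h : k[X]} {w : W q h} (hw : w ∈ tIdeal q h) :
    GWA.x 0 * w ∈ tIdeal q h := by
  obtain ⟨u, rfl⟩ := mem_tIdeal.1 hw
  exact mem_tIdeal.2 ⟨q • (GWA.x 0 * u), by
    rw [← mul_assoc, x_mul_t, smul_mul_assoc, mul_smul_comm, mul_assoc]⟩

theorem y_mul_mem_tIdeal {q : k} {h : k[X]} {w : W q h} (hw : w ∈ tIdeal q h) :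
    GWA.y 0 * w ∈ tIdeal q h := by
  obtain ⟨u, rfl⟩ := mem_tIdeal.1 hw
  exact mem_tIdeal.2 ⟨q⁻¹ • (GWA.y 0 * u), by
    rw [← mul_assoc, y_mul_t, smul_mul_assoc, mul_smul_comm, mul_assoc]⟩

theorem t_mul_mem_tIdeal {q : k} {h : k[X]} (w : W q h) : GWA.t * w ∈ tIdeal q h :=
  mem_tIdeal.2 ⟨w, rfl⟩

theorem commutator_x_t_mem (q : k) (h : k[X]) :
    (GWA.x 0 * GWA.t - GWA.t * GWA.x 0 : W q h) ∈ tIdeal q h := by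
  rw [x_mul_t]
  exact Submodule.sub_mem _ (Submodule.smul_mem _ _ (t_mul_mem_tIdeal _)) (t_mul_mem_tIdeal _)

theorem commutator_y_t_mem (q : k) (h : k[X]) :
    (GWA.y 0 * GWA.t - GWA.t * GWA.y 0 : W q h) ∈ tIdeal q h := by
  rw [y_mul_t]
  exact Submodule.sub_mem _ (Submodule.smul_mem _ _ (t_mul_mem_tIdeal _)) (t_mul_mem_tIdeal _)

theorem commutator_x_y_mem (q : k) (h : k[X]) :
    (GWA.x 0 * GWA.y 0 - GWA.y 0 * GWA.x 0 : W q h) ∈ tIdeal q h := by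
  rw [x_mul_y, y_mul_x, aeval_smul_t, ← map_sub]
  obtain ⟨p, hp⟩ : X ∣ h - shift q (-1) h := by
    rw [X_dvd_iff, coeff_sub, coeff_zero_eq_eval_zero, coeff_zero_eq_eval_zero, shift_eq_comp,
      eval_comp]
    simp
  rw [hp, map_mul, aeval_X]
  exact t_mul_mem_tIdeal _

theorem commutator_mem_of_generators {q : k} {h : k[X]} (g : W q h)
    (hx : g * GWA.x 0 - GWA.x 0 * g ∈ tIdeal q h) (hy : g * GWA.y 0 - GWA.y 0 * g ∈ tIdeal q h)
    (ht : g * GWA.t - GWA.t * g ∈ tIdeal q h) (w : W q h) : g * w - w * g ∈ tIdeal q h := by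
  have leibniz (u m : W q h) : g * (u * m) - u * m * g = (g * u - u * g) * m + u * (g * m - m * g) := by
    simp only [mul_sub, sub_mul, mul_assoc, sub_add_sub_cancel]
  refine induction_left
    ((tIdeal q h).comap (LinearMap.mulLeft k g - LinearMap.mulRight k g)) ?_ ?_ ?_ ?_ w
  · simp
  · intro m hm
    change g * (GWA.x 0 * m) - GWA.x 0 * m * g ∈ tIdeal q h
    rw [leibniz]
    exact Submodule.add_mem _ (tIdeal_mul_right hx m) (x_mul_mem_tIdeal hm)
  · intro m hm
    change g * (GWA.y 0 * m) - GWA.y 0 * m * g ∈ tIdeal q h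
    rw [leibniz]
    exact Submodule.add_mem _ (tIdeal_mul_right hy m) (y_mul_mem_tIdeal hm)
  · intro m hm
    change g * (GWA.t * m) - GWA.t * m * g ∈ tIdeal q h
    rw [leibniz]
    exact Submodule.add_mem _ (tIdeal_mul_right ht m) (t_mul_mem_tIdeal _)

theorem commutator_mem_tIdeal {q : k} {h : k[X]} (a b : W q h) : a * b - b * a ∈ tIdeal q h := by
  have swap {u v : W q h} (huv : u * v - v * u ∈ tIdeal q h) : v * u - u * v ∈ tIdeal q h := by
    rw [← neg_sub]
    exact Submodule.neg_mem _ huv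
  have self (u : W q h) : u * u - u * u ∈ tIdeal q h := by
    rw [sub_self]
    exact Submodule.zero_mem _
  refine commutator_mem_of_generators a (swap ?_) (swap ?_) (swap ?_) b
  · exact commutator_mem_of_generators _ (self _) (commutator_x_y_mem q h) (commutator_x_t_mem q h) a
  · exact commutator_mem_of_generators _ (swap (commutator_x_y_mem q h)) (self _)
      (commutator_y_t_mem q h) a
  · exact commutator_mem_of_generators _ (swap (commutator_x_t_mem q h))
      (swap (commutator_y_t_mem q h)) (self _) a

end Commutators

section Isomorphisms

variable {k : Type*} [Field k]

/-- The image of `t` under an isomorphism left-divides `tx` and `ty`. -/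
theorem image_t_dvd {q q' : k} {h H : k[X]} (φ : W q h ≃ₐ[k] W q' H) {u : W q' H} {c : k}
    (hc : c ≠ 1) (hu : u * GWA.t = c • (GWA.t * u)) : ∃ a, φ GWA.t * a = GWA.t * u := by
  obtain ⟨z, hz⟩ := mem_tIdeal.1 (commutator_mem_tIdeal (φ.symm u) (φ.symm GWA.t))
  have hz := congrArg φ hz
  simp only [map_mul, map_sub, AlgEquiv.apply_symm_apply, hu] at hz
  refine ⟨(c - 1)⁻¹ • φ z, ?_⟩
  have hv : c • (GWA.t * u) - GWA.t * u = (c - 1) • (GWA.t * u) := by module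
  rw [mul_smul_comm, hz, hv, smul_smul, inv_mul_cancel₀ (sub_ne_zero.2 hc), one_smul]

theorem t_ne_algebraMap {q : k} (hq : q ≠ 0) (h : k[X]) (c : k) :
    (GWA.t : W q h) ≠ algebraMap k _ c := by
  intro ht
  have := congrArg (rep hq h) ht
  rw [rep_t, ← aeval_C (GWA.t : W q h) c, rep_aeval_t, mon_inj] at this
  exact X_ne_C c this

theorem image_t_cases {q q' : k} {h H : k[X]} (hq : q ≠ 0) (hq' : q' ≠ 0) (hq1' : q' ≠ 1)
    (hH : 1 ≤ H.natDegree) (φ : W q h ≃ₐ[k] W q' H) :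
    (∃ c : k, c ≠ 0 ∧ φ GWA.t = c • GWA.t) ∨ ((∃ z, GWA.t = φ GWA.t * z) ∧
      ∃ (c : k) (n : ℤ), c ≠ 0 ∧ φ GWA.t = aeval (GWA.t : W q' H) (C c) * base q' H n) := by
  obtain ⟨a, ha⟩ := image_t_dvd φ hq1' (x_mul_t q' H)
  obtain ⟨b, hb⟩ := image_t_dvd φ (inv_ne_one.2 hq1') (y_mul_t q' H)
  refine (left_divisor_cases hq' hH ha hb).resolve_left ?_
  rintro ⟨c, hc⟩
  refine t_ne_algebraMap hq h c (φ.injective ?_)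
  rw [hc, AlgEquiv.commutes]

theorem image_t {q q' : k} {h H : k[X]} (hq : q ≠ 0) (hq1 : q ≠ 1) (hq' : q' ≠ 0) (hq1' : q' ≠ 1)
    (hh : 1 ≤ h.natDegree) (hH : 1 ≤ H.natDegree) (φ : W q h ≃ₐ[k] W q' H) :
    ∃ c : k, c ≠ 0 ∧ φ GWA.t = c • GWA.t := by
  have hh0 : h ≠ 0 := by rintro rfl; simp at hh
  rcases image_t_cases hq hq' hq1' hH φ with hφ | ⟨⟨z, hz⟩, -⟩
  · exact hφ
  rcases image_t_cases hq' hq hq1 hh φ.symm with ⟨c, hc, hφ⟩ | ⟨-, c, n, hc, hφ⟩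
  · refine ⟨c⁻¹, inv_ne_zero hc, ?_⟩
    rw [AlgEquiv.symm_apply_eq, map_smul] at hφ
    rw [hφ, smul_smul, inv_mul_cancel₀ hc, one_smul]
  · exfalso
    have hz := congrArg φ.symm hz
    rw [map_mul, AlgEquiv.symm_apply_apply, hφ] at hz
    obtain ⟨m, f, g, hf, hg, -, -, -⟩ := exists_factors hq hh0
      (mul_ne_zero (C_ne_zero.2 hc) (baseCoeff_ne_zero hq hh0 n))
      (hz ▸ rep_aeval_mul_base hq h (C c) n)
    have ht : (GWA.t : W q h) = aeval (GWA.t : W q h) (X : k[X]) * base q h 0 := by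
      rw [base_zero, mul_one, aeval_X]
    obtain ⟨rfl, rfl⟩ := aeval_mul_base_inj hq hh0 X_ne_zero (ht.symm.trans hf)
    rw [hg, sub_zero, ← mul_assoc] at hz
    nth_rewrite 2 [← aeval_X (R := k) (GWA.t : W q h)] at hz
    rw [← map_mul] at hz
    obtain ⟨-, hX⟩ := aeval_mul_base_inj hq hh0 (C_ne_zero.2 hc) hz
    have hg0 : g ≠ 0 := by
      rintro rfl
      rw [mul_zero, C_eq_zero] at hX
      exact hc hX
    have := congrArg natDegree hX
    rw [natDegree_C, natDegree_X_mul hg0] at this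
    omega

/-- An isomorphism maps `x` and `y` to homogeneous elements of opposite degrees. -/
theorem image_x_y {q q' : k} {h H : k[X]} (hq' : q' ≠ 0)
    (hh : h ≠ 0) (hH : H ≠ 0) (φ : W q h ≃ₐ[k] W q' H) {γ : k} (hγ : γ ≠ 0)
    (hφ : φ GWA.t = γ • GWA.t) :
    ∃ (n : ℤ) (f g : k[X]), q' ^ n = q ∧ f ≠ 0 ∧ g ≠ 0 ∧
      f * baseCoeff q' H n * shift q' n (g * baseCoeff q' H (-n)) = h.comp (C γ * X) := by
  have hγh : h.comp (C γ * X) ≠ 0 := by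
    intro h0
    apply hh
    have := congrArg (fun p : k[X] => p.comp (C γ⁻¹ * X)) h0
    simpa [comp_assoc, ← mul_assoc, ← C_mul, mul_inv_cancel₀ hγ] using this
  have hrep_t : rep hq' H (φ GWA.t) = mon q' 0 (C γ * X) := by
    rw [hφ, map_smul, rep_t, ← mon_smul, smul_eq_C_mul]
  obtain ⟨n, f, g, hf, -, hf0, hg0, hfg⟩ := exists_factors hq' hH (d := 0)
    (a := φ (GWA.x 0)) (b := φ (GWA.y 0)) hγh (by
      rw [← map_mul, x_mul_y, ← aeval_algHom_apply, ← aeval_algHom_apply, hrep_t,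
        aeval_mon_zero hq'])
  rw [zero_sub] at hfg
  refine ⟨n, f, g, ?_, hf0, hg0, hfg⟩
  have hxt := congrArg (fun w => rep hq' H (φ w)) (x_mul_t q h)
  have hF := mul_ne_zero hf0 (baseCoeff_ne_zero hq' hH n)
  simp only [map_mul, map_smul] at hxt
  rw [hrep_t, hf, rep_aeval_mul_base, mon_mul_mon hq', mon_mul_mon hq', ← mon_smul, add_zero,
    zero_add, mon_inj, shift_zero, map_mul, shift_C, shift_X, mul_comm (C γ * X),
    ← mul_smul_comm] at hxt
  have := mul_left_cancel₀ hF hxt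
  rw [smul_eq_C_mul, ← mul_assoc, ← mul_assoc, ← C_mul, ← C_mul] at this
  have := C_injective (mul_right_cancel₀ X_ne_zero this)
  rw [mul_comm] at this
  exact mul_right_cancel₀ hγ this

theorem natDegree_le_of_equiv {q q' : k} {h H : k[X]} (hq : q ≠ 0) (hq1 : q ≠ 1) (hq' : q' ≠ 0)
    (hq1' : q' ≠ 1) (hh : 1 ≤ h.natDegree) (hH : 1 ≤ H.natDegree) (φ : W q h ≃ₐ[k] W q' H) :
    H.natDegree ≤ h.natDegree := by
  have hh0 : h ≠ 0 := by rintro rfl; simp at hh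
  have hH0 : H ≠ 0 := by rintro rfl; simp at hH
  obtain ⟨γ, hγ, hφ⟩ := image_t hq hq1 hq' hq1' hh hH φ
  obtain ⟨n, f, g, hn, hf, hg, hfg⟩ := image_x_y hq' hh0 hH0 φ hγ hφ
  have hd := congrArg natDegree hfg
  rw [natDegree_factors hq' hH0 hf hg, natDegree_comp, natDegree_C_mul_X _ hγ, mul_one] at hd
  have hn0 : n ≠ 0 := by
    rintro rfl
    exact hq1 (by rw [← hn, zpow_zero])
  rcases lt_or_gt_of_ne hn0 with h0 | h0
  · have := Nat.le_mul_of_pos_left H.natDegree (show 0 < (-n).toNat by omega)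
    omega
  · have := Nat.le_mul_of_pos_left H.natDegree (show 0 < (- -n).toNat by omega)
    omega

theorem parameters_of_equiv {q q' : k} {h H : k[X]} (hq : q ≠ 0) (hq1 : q ≠ 1) (hq' : q' ≠ 0)
    (hq1' : q' ≠ 1) (hh : 1 ≤ h.natDegree) (hH : 1 ≤ H.natDegree) (φ : W q h ≃ₐ[k] W q' H) :
    (q' = q ∧ ∃ γ μ : k, γ ≠ 0 ∧ μ ≠ 0 ∧ h.comp (C γ * X) = C μ * H) ∨
      (q' = q⁻¹ ∧ ∃ γ μ : k, γ ≠ 0 ∧ μ ≠ 0 ∧ h.comp (C γ * X) = C μ * H.comp (C q * X)) := by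
  have hh0 : h ≠ 0 := by rintro rfl; simp at hh
  have hH0 : H ≠ 0 := by rintro rfl; simp at hH
  have hle := natDegree_le_of_equiv hq' hq1' hq hq1 hH hh φ.symm
  obtain ⟨γ, hγ, hφ⟩ := image_t hq hq1 hq' hq1' hh hH φ
  obtain ⟨n, f, g, hn, hf, hg, hfg⟩ := image_x_y hq' hh0 hH0 φ hγ hφ
  have hd := congrArg natDegree hfg
  rw [natDegree_factors hq' hH0 hf hg, natDegree_comp, natDegree_C_mul_X _ hγ, mul_one] at hd
  have hn0 : n ≠ 0 := by
    rintro rfl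
    exact hq1 (by rw [← hn, zpow_zero])
  rcases lt_or_gt_of_ne hn0 with h0 | h0
  · obtain ⟨N, rfl⟩ : ∃ N : ℕ, n = -(N + 1) := ⟨(-n - 1).toNat, by omega⟩
    rw [show (-(-((N : ℤ) + 1))).toNat = N + 1 by omega, add_mul, one_mul] at hd
    obtain rfl : N = 0 := by
      by_contra hN
      have := Nat.mul_le_mul (Nat.one_le_iff_ne_zero.2 hN) hH
      omega
    obtain ⟨a, ha, rfl⟩ := exists_C_of_natDegree_eq_zero hf (by omega)
    obtain ⟨b, hb, rfl⟩ := exists_C_of_natDegree_eq_zero hg (by omega)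
    simp only [Nat.cast_zero, zero_add, neg_neg] at hfg hn
    rw [zpow_neg_one] at hn
    rw [baseCoeff_neg_one, baseCoeff_of_nonneg _ _ zero_le_one, mul_one, shift_C, shift_eq_comp,
      zpow_neg_one, hn] at hfg
    refine Or.inr ⟨by rw [← hn, inv_inv], γ, a * b, hγ, mul_ne_zero ha hb, ?_⟩
    rw [← hfg, C_mul]
    ring
  · obtain ⟨N, rfl⟩ : ∃ N : ℕ, n = N + 1 := ⟨(n - 1).toNat, by omega⟩
    rw [show (- -((N : ℤ) + 1)).toNat = N + 1 by omega, add_mul, one_mul] at hd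
    obtain rfl : N = 0 := by
      by_contra hN
      have := Nat.mul_le_mul (Nat.one_le_iff_ne_zero.2 hN) hH
      omega
    obtain ⟨a, ha, rfl⟩ := exists_C_of_natDegree_eq_zero hf (by omega)
    obtain ⟨b, hb, rfl⟩ := exists_C_of_natDegree_eq_zero hg (by omega)
    simp only [Nat.cast_zero, zero_add] at hfg hn
    rw [zpow_one] at hn
    rw [baseCoeff_neg_one, baseCoeff_of_nonneg _ _ zero_le_one, mul_one, map_mul, shift_C,
      shift_shift hq', add_neg_cancel, shift_zero] at hfg
    refine Or.inl ⟨hn, γ, a * b, hγ, mul_ne_zero ha hb, ?_⟩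
    rw [← hfg, C_mul, mul_assoc]

theorem exists_scale_hom {q : k} {h H : k[X]} {γ μ : k}
    (hγ : h.comp (C γ * X) = C μ * H) :
    ∃ f : W q h →ₐ[k] W q H, f (GWA.x 0) = μ • GWA.x 0 ∧ f (GWA.y 0) = GWA.y 0 ∧
      f GWA.t = γ • GWA.t := by
  have key (s : W q H) : aeval (γ • s) h = μ • aeval s H := by
    rw [Algebra.smul_def μ, ← aeval_C s μ, ← map_mul, ← hγ, aeval_comp, map_mul, aeval_C, aeval_X,
      Algebra.smul_def]
  apply exists_lift
  · simp only [smul_mul_assoc, mul_smul_comm, x_mul_t]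
    module
  · simp only [smul_mul_assoc, mul_smul_comm, y_mul_t]
    module
  · rw [key, smul_mul_assoc, x_mul_y]
  · rw [smul_comm, key, mul_smul_comm, y_mul_x]

theorem exists_swap_hom {q q' : k} {h H : k[X]} (hq : q ≠ 0) (hq' : q' = q⁻¹) {γ μ ν : k}
    (hγ : h.comp (C γ * X) = C (μ * ν) * H.comp (C q * X)) :
    ∃ f : W q h →ₐ[k] W q' H, f (GWA.x 0) = μ • GWA.y 0 ∧ f (GWA.y 0) = ν • GWA.x 0 ∧
      f GWA.t = γ • GWA.t := by
  subst hq'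
  have key (s : W q⁻¹ H) : aeval (γ • s) h = (μ * ν) • aeval (q • s) H := by
    have := congrArg (aeval s) hγ
    have scale (c : k) : aeval s (C c * X) = c • s := by
      rw [map_mul, aeval_C, aeval_X, Algebra.smul_def]
    rwa [aeval_comp, scale, ← smul_eq_C_mul, map_smul, aeval_comp, scale] at this
  apply exists_lift
  · simp only [smul_mul_assoc, mul_smul_comm, y_mul_t, inv_inv]
    module
  · simp only [smul_mul_assoc, mul_smul_comm, x_mul_t]
    module
  · rw [key, smul_mul_smul_comm, y_mul_x, inv_inv]
  · rw [smul_comm, key, smul_mul_smul_comm, x_mul_y, smul_smul, mul_inv_cancel₀ hq, one_smul,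
      mul_comm]

theorem nonempty_equiv_of_scale {q : k} {h H : k[X]} {γ μ : k} (hγ0 : γ ≠ 0) (hμ0 : μ ≠ 0)
    (hγ : h.comp (C γ * X) = C μ * H) : Nonempty (W q h ≃ₐ[k] W q H) := by
  have hγ' : H.comp (C γ⁻¹ * X) = C μ⁻¹ * h := by
    have := congrArg (fun p : k[X] => C μ⁻¹ * p.comp (C γ⁻¹ * X)) hγ
    simpa [comp_assoc, ← mul_assoc, ← C_mul, mul_inv_cancel₀ hγ0, inv_mul_cancel₀ hμ0] using this.symm
  obtain ⟨f, fx, fy, ft⟩ := exists_scale_hom (q := q) hγ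
  obtain ⟨g, gx, gy, gt⟩ := exists_scale_hom (q := q) hγ'
  refine ⟨AlgEquiv.ofAlgHom f g (hom_ext ?_ ?_ ?_) (hom_ext ?_ ?_ ?_)⟩ <;>
    simp [fx, fy, ft, gx, gy, gt, smul_smul, hγ0, hμ0]

theorem nonempty_equiv_of_swap {q q' : k} {h H : k[X]} (hq : q ≠ 0) (hq' : q' = q⁻¹) {γ μ : k}
    (hγ0 : γ ≠ 0) (hμ0 : μ ≠ 0) (hγ : h.comp (C γ * X) = C μ * H.comp (C q * X)) :
    Nonempty (W q h ≃ₐ[k] W q' H) := by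
  have hγ' : H.comp (C γ⁻¹ * X) = C (1 * μ⁻¹) * h.comp (C q' * X) := by
    have := congrArg (fun p : k[X] => C μ⁻¹ * p.comp (C (q' * γ⁻¹) * X)) hγ
    rw [hq'] at this ⊢
    simp only [comp_assoc, mul_comp, C_comp, X_comp, ← mul_assoc, ← C_mul] at this
    rw [inv_mul_cancel₀ hμ0, mul_inv_cancel₀ hq, one_mul, C_1, one_mul,
      show γ * q⁻¹ * γ⁻¹ = q⁻¹ by field_simp] at this
    rw [one_mul, this]
  obtain ⟨f, fx, fy, ft⟩ := exists_swap_hom (μ := μ) (ν := 1) hq hq' (by rwa [mul_one])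
  obtain ⟨g, gx, gy, gt⟩ := exists_swap_hom (hq' ▸ inv_ne_zero hq)
    (show q = q'⁻¹ by rw [hq', inv_inv]) hγ'
  refine ⟨AlgEquiv.ofAlgHom f g (hom_ext ?_ ?_ ?_) (hom_ext ?_ ?_ ?_)⟩ <;>
    simp [fx, fy, ft, gx, gy, gt, smul_smul, hγ0, hμ0]

/-- Rescaling the variable by `q²` exchanges the factors `q` and `q⁻¹`. -/
theorem exists_rescale_iff {q : k} (hq : q ≠ 0) (h H : k[X]) :
    (∃ γ μ : k, γ ≠ 0 ∧ μ ≠ 0 ∧ h.comp (C γ * X) = C μ * H.comp (C q⁻¹ * X)) ↔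
      ∃ γ μ : k, γ ≠ 0 ∧ μ ≠ 0 ∧ h.comp (C γ * X) = C μ * H.comp (C q * X) := by
  have key {r : k} (hr : r ≠ 0) : (∃ γ μ : k, γ ≠ 0 ∧ μ ≠ 0 ∧
      h.comp (C γ * X) = C μ * H.comp (C r⁻¹ * X)) →
      ∃ γ μ : k, γ ≠ 0 ∧ μ ≠ 0 ∧ h.comp (C γ * X) = C μ * H.comp (C r * X) := by
    rintro ⟨γ, μ, hγ, hμ, he⟩
    refine ⟨γ * (r * r), μ, mul_ne_zero hγ (mul_ne_zero hr hr), hμ, ?_⟩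
    have := congrArg (fun p : k[X] => p.comp (C (r * r) * X)) he
    simpa only [comp_assoc, mul_comp, C_comp, X_comp, ← mul_assoc, ← C_mul, inv_mul_cancel₀ hr,
      one_mul] using this
  refine ⟨key hq, fun he => key (inv_ne_zero hq) ?_⟩
  rwa [inv_inv]

end Isomorphisms

end QuantumGWA

/-- Proposition 6.4; one case of Suárez-Álvarez–Vivas, Theorem A.
Let `W`, `W'` be degree one quantum GWAs with parameters `(q, h)` and `(q', H)`, where
`q, q'` are roots of unity different from `0, 1` and `h, H` are nonconstant.  Then
`W ≅ W'` as `k`-algebras iff either `q' = q` and `h(γT) = μ·H(T)` for some `γ, μ ∈ kˣ`,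
or `q' = q⁻¹` and `h(γT) = μ·H(q⁻¹T)` for some `γ, μ ∈ kˣ`. -/
theorem isomorphism_of_degree_one_quantum_GWAs
    (k : Type*) [Field k] (q₀ q₀' : k) (h₀ H₀ : Polynomial k)
    (hq : IsOfFinOrder q₀) (hq' : IsOfFinOrder q₀')
    (hq0 : q₀ ≠ 0) (hq1 : q₀ ≠ 1) (hq0' : q₀' ≠ 0) (hq1' : q₀' ≠ 1)
    (hh : 1 ≤ h₀.natDegree) (hH : 1 ≤ H₀.natDegree) :
    Nonempty
        (GWA k 1 (fun _ => q₀) (fun _ => h₀) ≃ₐ[k] GWA k 1 (fun _ => q₀') (fun _ => H₀)) ↔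
      ((q₀' = q₀ ∧ ∃ γ μ : kˣ,
          h₀.comp (C (γ : k) * X) = C (μ : k) * H₀) ∨
       (q₀' = q₀⁻¹ ∧ ∃ γ μ : kˣ,
          h₀.comp (C (γ : k) * X) = C (μ : k) * (H₀.comp (C q₀⁻¹ * X)))) := by
  have units (P : k → k → Prop) :
      (∃ γ μ : kˣ, P γ μ) ↔ ∃ γ μ : k, γ ≠ 0 ∧ μ ≠ 0 ∧ P γ μ :=
    ⟨fun ⟨γ, μ, hP⟩ => ⟨γ, μ, γ.ne_zero, μ.ne_zero, hP⟩,
      fun ⟨γ, μ, hγ, hμ, hP⟩ => ⟨Units.mk0 γ hγ, Units.mk0 μ hμ, hP⟩⟩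
  rw [units fun γ μ => h₀.comp (C γ * X) = C μ * H₀,
    units fun γ μ => h₀.comp (C γ * X) = C μ * H₀.comp (C q₀⁻¹ * X),
    QuantumGWA.exists_rescale_iff hq0]
  constructor
  · rintro ⟨φ⟩
    exact QuantumGWA.parameters_of_equiv hq0 hq1 hq0' hq1' hh hH φ
  · rintro (⟨rfl, γ, μ, hγ, hμ, he⟩ | ⟨hqq, γ, μ, hγ, hμ, he⟩)
    · exact QuantumGWA.nonempty_equiv_of_scale hγ hμ he
    · exact QuantumGWA.nonempty_equiv_of_swap hq0 hqq hγ hμ he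
end
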